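/- Let Ω ⊂ ℝ² be a compact strictly convex domain with smooth boundary, α : ∂Ω → ℝ smooth, and let u : closure(Ω) × [0,T) → ℝ be a smooth solution of graphical spacelike mean curvature flow with α-Neumann boundary condition and initial value u₀. Set ᾱ := sup_{∂Ω}|α|, C_α := sup_{∂Ω} |dα/ds| (the tangential derivative of α along the boundary curve), κ̲ := inf_{∂Ω} κ > 0, and C_H := sup_{x∈Ω} |u_t(x,0)|. Then for every (x,t) ∈ closure(Ω) × [0,T), 1/√(1−|Du(x,t)|²) ≤ C, where C = max{ 2√(1+ᾱ²), (1+ᾱ²)(κ̲⁻¹ ᾱ C_H + κ̲⁻¹(2ᾱ²+1)C_α + 1), sup_{x∈Ω} 1/√(1−|Du₀(x)|²) }. In particular |Du(x,t)| is bounded away from 1 uniformly in t. -/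

import Mathlib

open Set

noncomputable section

/-- The `i`-th spatial partial derivative (within `closure Ω`) of `u(·,t)`,
i.e. `Dᵢu(x,t)`. -/
def spGrad {n : ℕ} (Ω : Set (Fin n → ℝ)) (u : (Fin n → ℝ) → ℝ → ℝ)
    (x : Fin n → ℝ) (t : ℝ) (i : Fin n) : ℝ :=
  fderivWithin ℝ (fun y => u y t) (closure Ω) x (Pi.single i 1)

/-- `|Du(x,t)|²`. -/
def spGradSq {n : ℕ} (Ω : Set (Fin n → ℝ)) (u : (Fin n → ℝ) → ℝ → ℝ)
    (x : Fin n → ℝ) (t : ℝ) : ℝ :=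
  ∑ i, (spGrad Ω u x t i) ^ 2

/-- `u` is a smooth solution of graphical spacelike mean curvature flow on
`closure Ω × J` with `α`-Neumann boundary condition, where `γ` is the outward
unit normal of `∂Ω`:  `|Du| < 1` (spacelike),
`u_t = √(1-|Du|²) ∑ᵢ Dᵢ(Dᵢu/√(1-|Du|²))` on `Ω × J`, and
`γ·Du = α √(1-|Du|²)` on `∂Ω × J`. -/
structure IsGraphMCF {n : ℕ} (Ω : Set (Fin n → ℝ)) (γ : (Fin n → ℝ) → Fin n → ℝ)
    (α : (Fin n → ℝ) → ℝ) (J : Set ℝ) (u : (Fin n → ℝ) → ℝ → ℝ) : Prop where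
  smooth : ContDiffOn ℝ (⊤ : ℕ∞) (fun q : (Fin n → ℝ) × ℝ => u q.1 q.2) ((closure Ω) ×ˢ J)
  spacelike : ∀ x ∈ closure Ω, ∀ t ∈ J, spGradSq Ω u x t < 1
  pde : ∀ x ∈ Ω, ∀ t ∈ J,
      derivWithin (fun s => u x s) J t =
        Real.sqrt (1 - spGradSq Ω u x t) *
          ∑ i, fderivWithin ℝ
            (fun y => spGrad Ω u y t i / Real.sqrt (1 - spGradSq Ω u y t))
            (closure Ω) x (Pi.single i 1)
  neumann : ∀ x ∈ frontier Ω, ∀ t ∈ J,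
      (∑ i, γ x i * spGrad Ω u x t i) = α x * Real.sqrt (1 - spGradSq Ω u x t)

section Helpers

open Topology Filter

section DirectionalDerivative

variable {V : Type*} [NormedAddCommGroup V] [NormedSpace ℝ V] {S : Set V} {f g : V → ℝ}

/-- The derivative of `f` within `S` in the direction `d`. -/
def dirDeriv (S : Set V) (d : V) (f : V → ℝ) (q : V) : ℝ := fderivWithin ℝ f S q d

lemma ContDiffOn.dirDeriv (hf : ContDiffOn ℝ (⊤ : ℕ∞) f S) (hS : UniqueDiffOn ℝ S) (d : V) :
    ContDiffOn ℝ (⊤ : ℕ∞) (dirDeriv S d f) S :=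
  (hf.fderivWithin (m := (⊤ : ℕ∞)) hS (by simp)).clm_apply contDiffOn_const

lemma ContDiffOn.hasFDerivWithinAt' (hf : ContDiffOn ℝ (⊤ : ℕ∞) f S) {q : V} (hq : q ∈ S) :
    HasFDerivWithinAt f (fderivWithin ℝ f S q) S q :=
  (hf.differentiableOn (by simp) q hq).hasFDerivWithinAt

lemma HasFDerivWithinAt.dirDeriv_eq {f' : V →L[ℝ] ℝ} {q : V} (hf : HasFDerivWithinAt f f' S q)
    (hS : UniqueDiffOn ℝ S) (hq : q ∈ S) (d : V) : dirDeriv S d f q = f' d := by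
  rw [dirDeriv, hf.fderivWithin (hS q hq)]

lemma dirDeriv_congr (h : EqOn f g S) (d : V) : EqOn (dirDeriv S d f) (dirDeriv S d g) S :=
  fun q hq => by rw [dirDeriv, dirDeriv, fderivWithin_congr h (h hq)]

lemma dirDeriv_comm (hf : ContDiffOn ℝ (⊤ : ℕ∞) f S) (hS : UniqueDiffOn ℝ S)
    (hcl : S ⊆ closure (interior S)) (d e : V) :
    EqOn (dirDeriv S d (dirDeriv S e f)) (dirDeriv S e (dirDeriv S d f)) S := by
  intro q hq
  have key : ∀ a b : V, dirDeriv S a (dirDeriv S b f) q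
      = fderivWithin ℝ (fderivWithin ℝ f S) S q a b := by
    intro a b
    have h1 : HasFDerivWithinAt (fderivWithin ℝ f S)
        (fderivWithin ℝ (fderivWithin ℝ f S) S q) S q :=
      ((hf.fderivWithin (m := (⊤ : ℕ∞)) hS (by simp)).differentiableOn (by simp)
        q hq).hasFDerivWithinAt
    have h2 := h1.clm_apply (hasFDerivWithinAt_const b q S)
    have h3 : dirDeriv S a (dirDeriv S b f) q = _ := h2.dirDeriv_eq hS hq a
    rw [h3]
    simp
  rw [key, key]
  exact ((hf q hq).isSymmSndFDerivWithinAt (by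
    rw [minSmoothness_of_isRCLikeNormedField]
    exact WithTop.coe_le_coe.2 le_top) hS (hcl hq) hq) d e

lemma dirDeriv_add_dir (d e : V) (q : V) :
    dirDeriv S (d + e) f q = dirDeriv S d f q + dirDeriv S e f q := map_add _ _ _

lemma dirDeriv_smul_dir (a : ℝ) (d : V) (q : V) :
    dirDeriv S (a • d) f q = a * dirDeriv S d f q := by simp [dirDeriv]

end DirectionalDerivative

/-- Second derivative test, necessary condition. -/
lemma IsLocalMax.second_deriv_nonpos {g g' : ℝ → ℝ} {a b : ℝ} (hmax : IsLocalMax g a)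
    (hg : ∀ᶠ r in 𝓝 a, HasDerivAt g (g' r) r) (hg' : HasDerivAt g' b a) : b ≤ 0 := by
  by_contra! hb
  have h1 : deriv g =ᶠ[𝓝 a] g' := hg.mono fun r hr => hr.deriv
  have h2 : deriv (deriv g) a = b := by rw [h1.deriv_eq, hg'.deriv]
  have hmin := isLocalMin_of_deriv_deriv_pos (h2 ▸ hb) hmax.deriv_eq_zero
    hg.self_of_nhds.continuousAt
  have hconst : g =ᶠ[𝓝 a] fun _ => g a := by
    filter_upwards [hmax, hmin] with r h3 h4 using le_antisymm h3 h4
  have h5 : deriv g =ᶠ[𝓝 a] fun _ => 0 := by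
    filter_upwards [hconst.eventuallyEq_nhds] with r hr
    rw [hr.deriv_eq]; simp
  rw [h5.deriv_eq] at h2
  simp at h2
  linarith

section ConvexBoundary

variable {Ω : Set (Fin 2 → ℝ)} {γ : (Fin 2 → ℝ) → Fin 2 → ℝ} {c : ℝ → Fin 2 → ℝ}

lemma frame_cases {g τ : Fin 2 → ℝ} (hg : ∑ i, (g i) ^ 2 = 1) (hτ : ∑ i, (τ i) ^ 2 = 1)
    (h : ∑ i, g i * τ i = 0) :
    (τ 0 = -(g 1) ∧ τ 1 = g 0) ∨ (τ 0 = g 1 ∧ τ 1 = -(g 0)) := by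
  simp only [Fin.sum_univ_two] at hg hτ h
  have h1 : (g 0 * τ 1 - g 1 * τ 0) ^ 2 = 1 := by
    linear_combination (τ 0 ^ 2 + τ 1 ^ 2) * hg + hτ - (g 0 * τ 0 + g 1 * τ 1) * h
  have h2 : (g 0 * τ 1 - g 1 * τ 0 - 1) * (g 0 * τ 1 - g 1 * τ 0 + 1) = 0 := by
    linear_combination h1
  rcases mul_eq_zero.1 h2 with h3 | h3
  · left
    constructor
    · linear_combination g 0 * h - g 1 * h3 - τ 0 * hg
    · linear_combination g 1 * h + g 0 * h3 - τ 1 * hg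
  · right
    constructor
    · linear_combination g 0 * h - g 1 * h3 - τ 0 * hg
    · linear_combination g 1 * h + g 0 * h3 - τ 1 * hg

lemma frame_decomp {g τ : Fin 2 → ℝ} (hg : ∑ i, (g i) ^ 2 = 1) (hτ : ∑ i, (τ i) ^ 2 = 1)
    (h : ∑ i, g i * τ i = 0) (y : Fin 2 → ℝ) :
    y = (∑ i, g i * y i) • g + (∑ i, τ i * y i) • τ := by
  have hc := frame_cases hg hτ h
  simp only [Fin.sum_univ_two] at *
  ext i
  rcases hc with ⟨h0, h1⟩ | ⟨h0, h1⟩ <;> fin_cases i <;>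
    simp only [Fin.zero_eta, Fin.mk_one, Pi.add_apply, Pi.smul_apply, smul_eq_mul, h0, h1]
  · linear_combination -(y 0) * hg
  · linear_combination -(y 1) * hg
  · linear_combination -(y 0) * hg
  · linear_combination -(y 1) * hg

lemma normal_pos (hΩo : IsOpen Ω) (hγunit : ∀ x ∈ frontier Ω, ∑ i, (γ x i) ^ 2 = 1)
    (hγout : ∀ x ∈ frontier Ω, ∀ y ∈ Ω, ∑ i, γ x i * (y i - x i) ≤ 0)
    {x x₀ : Fin 2 → ℝ} (hx : x ∈ frontier Ω) (hx₀ : x₀ ∈ Ω) :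
    0 < ∑ i, γ x i * (x i - x₀ i) := by
  have hcont : Continuous fun r : ℝ => x₀ + r • γ x := by fun_prop
  have hmem : ∀ᶠ r in 𝓝[>] (0 : ℝ), x₀ + r • γ x ∈ Ω :=
    nhdsWithin_le_nhds (hcont.continuousAt.eventually_mem (hΩo.mem_nhds (by simpa using hx₀)))
  obtain ⟨r, hr, hr0⟩ := (hmem.and self_mem_nhdsWithin).exists
  have h1 := hγout x hx _ hr
  have h2 := hγunit x hx
  simp only [Fin.sum_univ_two, Pi.add_apply, Pi.smul_apply, smul_eq_mul] at *
  have hr0' : 0 < r := hr0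
  nlinarith

lemma inner_normal_tangent (hcunit : ∀ s, ∑ i, (deriv c s i) ^ 2 = 1)
    (hc : ContDiff ℝ (⊤ : ℕ∞) c) {κ : ℝ → ℝ}
    (hccurv : ∀ s, deriv (deriv c) s = (-(κ s)) • γ (c s)) (hκpos : ∀ s, 0 < κ s) (s : ℝ) :
    ∑ i, γ (c s) i * deriv c s i = 0 := by
  have hc2 : HasDerivAt (deriv c) (deriv (deriv c) s) s := by
    have : ContDiff ℝ (⊤ : ℕ∞) (deriv c) := (contDiff_infty_iff_deriv.1 hc).2
    exact (this.differentiable (by simp) s).hasDerivAt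
  rw [hccurv] at hc2
  have hi := hasDerivAt_pi.1 hc2
  have h1 : HasDerivAt (fun s => ∑ i, (deriv c s i) ^ 2) _ s :=
    HasDerivAt.fun_sum fun i _ => (hi i).pow 2
  simp only [hcunit] at h1
  have h2 := h1.unique (hasDerivAt_const s (1 : ℝ))
  simp [Fin.sum_univ_two] at h2 ⊢
  have h3 := hκpos s
  have : κ s * (γ (c s) 0 * deriv c s 0 + γ (c s) 1 * deriv c s 1) = 0 := by linarith
  exact (mul_eq_zero.1 this).resolve_left h3.ne.symm

/-- The Frenet equation: along the boundary curve, the derivative of the normal is `κ` times the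
tangent. -/
lemma hasDerivAt_normal (hcunit : ∀ s, ∑ i, (deriv c s i) ^ 2 = 1)
    (hc : ContDiff ℝ (⊤ : ℕ∞) c) {κ : ℝ → ℝ} (hγunit : ∀ s, ∑ i, (γ (c s) i) ^ 2 = 1)
    (hccurv : ∀ s, deriv (deriv c) s = (-(κ s)) • γ (c s)) (hκpos : ∀ s, 0 < κ s) (s : ℝ) :
    HasDerivAt (fun r => γ (c r)) (κ s • deriv c s) s := by
  have hcs1 : ContDiff ℝ (⊤ : ℕ∞) (deriv c) := (contDiff_infty_iff_deriv.1 hc).2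
  have hcs2 : ContDiff ℝ (⊤ : ℕ∞) (deriv (deriv c)) := (contDiff_infty_iff_deriv.1 hcs1).2
  have hd2 : Differentiable ℝ (deriv (deriv c)) := hcs2.differentiable (by simp)
  have hκ : κ = fun r => √(∑ i, (deriv (deriv c) r i) ^ 2) := by
    funext r
    have : ∑ i, (deriv (deriv c) r i) ^ 2 = (κ r) ^ 2 := by
      have h := hγunit r
      simp only [hccurv, Fin.sum_univ_two, Pi.smul_apply, smul_eq_mul] at h ⊢
      linear_combination κ r ^ 2 * h
    rw [this, Real.sqrt_sq (hκpos r).le]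
  have hκd : DifferentiableAt ℝ κ s := by
    have h0 : ∑ i, (deriv (deriv c) s i) ^ 2 ≠ 0 := by
      intro h0
      have h1 := hκpos s
      rw [hκ] at h1
      simp [h0] at h1
    rw [hκ]
    refine DifferentiableAt.sqrt ?_ h0
    refine DifferentiableAt.fun_sum fun i _ => ?_
    exact (differentiableAt_pi.1 (hd2 s) i).pow 2
  have hn : (fun r => γ (c r)) = fun r => (-(κ r)⁻¹) • deriv (deriv c) r := by
    funext r
    rw [hccurv, smul_smul, neg_mul_neg, inv_mul_cancel₀ (hκpos r).ne', one_smul]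
  have hnd : DifferentiableAt ℝ (fun r => γ (c r)) s := by
    rw [hn]
    exact ((hκd.inv (hκpos s).ne').neg).smul (hd2 s)
  have hnd' := hnd.hasDerivAt
  set n' := deriv (fun r => γ (c r)) s
  have hi := hasDerivAt_pi.1 hnd'
  have hti := hasDerivAt_pi.1 ((hcs1.differentiable (by simp) s).hasDerivAt)
  have h1 : HasDerivAt (fun r => ∑ i, (γ (c r) i) ^ 2) _ s :=
    HasDerivAt.fun_sum fun i _ => (hi i).pow 2
  simp only [hγunit] at h1
  have h2 := h1.unique (hasDerivAt_const s (1 : ℝ))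
  have h3 : HasDerivAt (fun r => ∑ i, γ (c r) i * deriv c r i) _ s :=
    HasDerivAt.fun_sum fun i _ => (hi i).mul (hti i)
  have hperp := inner_normal_tangent hcunit hc hccurv hκpos
  simp only [hperp] at h3
  have h4 := h3.unique (hasDerivAt_const s (0 : ℝ))
  have h5 := hγunit s
  have hdec := frame_decomp (hγunit s) (hcunit s) (hperp s) n'
  have hn1 : ∑ i, γ (c s) i * n' i = 0 := by
    simp [Fin.sum_univ_two] at h2 ⊢
    linarith
  have hn2 : ∑ i, deriv c s i * n' i = κ s := by
    simp [Fin.sum_univ_two, hccurv] at h4 h5 ⊢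
    linear_combination h4 + κ s * h5
  rw [hn1, hn2, zero_smul, zero_add] at hdec
  rwa [← hdec]

/-- Near every point other than the base point, the gauge of a domain with smooth boundary is
smooth. -/
lemma contDiffAt_gauge_translate (hΩo : IsOpen Ω) (hΩconv : Convex ℝ Ω)
    (hΩbd : Bornology.IsBounded Ω)
    (hγunit : ∀ x ∈ frontier Ω, ∑ i, (γ x i) ^ 2 = 1)
    (hγout : ∀ x ∈ frontier Ω, ∀ y ∈ Ω, ∑ i, γ x i * (y i - x i) ≤ 0)
    (hc : ContDiff ℝ (⊤ : ℕ∞) c) (hcrange : range c = frontier Ω)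
    (hcunit : ∀ s, ∑ i, (deriv c s i) ^ 2 = 1)
    (hperp : ∀ s, ∑ i, γ (c s) i * deriv c s i = 0)
    {x₀ : Fin 2 → ℝ} (hx₀ : x₀ ∈ Ω) {D : Set (Fin 2 → ℝ)} (hD : D = (fun y => y + x₀) ⁻¹' Ω)
    {y : Fin 2 → ℝ} (hy : y ≠ 0) : ContDiffAt ℝ (⊤ : ℕ∞) (gauge D) y := by
  have hDfr : ∀ z, z ∈ frontier D ↔ z + x₀ ∈ frontier Ω := by
    intro z
    have : D = (Homeomorph.addRight x₀) ⁻¹' Ω := hD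
    rw [this, ← Homeomorph.preimage_frontier]; rfl
  have hDconv : Convex ℝ D := hD ▸ hΩconv.translate_preimage_left x₀
  have hD0 : D ∈ 𝓝 (0 : Fin 2 → ℝ) := by
    rw [hD]
    refine (hΩo.preimage (by fun_prop)).mem_nhds ?_
    simpa using hx₀
  have hDbd : Bornology.IsVonNBounded ℝ D := by
    rw [NormedSpace.isVonNBounded_iff]
    obtain ⟨M, hM⟩ := hΩbd.exists_norm_le
    refine isBounded_iff_forall_norm_le.2 ⟨M + ‖x₀‖, fun z hz => ?_⟩
    rw [hD] at hz
    have h1 := hM _ hz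
    calc ‖z‖ = ‖(z + x₀) - x₀‖ := by simp
      _ ≤ ‖z + x₀‖ + ‖x₀‖ := norm_sub_le _ _
      _ ≤ _ := by gcongr
  have hr : 0 < gauge D y := (gauge_pos (absorbent_nhds_zero hD0) hDbd).2 hy
  set r := gauge D y with hrdef
  have hfr : ∀ s, gauge D (c s - x₀) = 1 := fun s => by
    rw [gauge_eq_one_iff_mem_frontier hDconv hD0, hDfr, sub_add_cancel, ← hcrange]
    exact mem_range_self s
  obtain ⟨s, hs⟩ : ∃ s, c s = r⁻¹ • y + x₀ := by
    have : r⁻¹ • y + x₀ ∈ frontier Ω := by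
      rw [← hDfr, ← gauge_eq_one_iff_mem_frontier hDconv hD0,
        gauge_smul_of_nonneg (inv_nonneg.2 hr.le), ← hrdef, smul_eq_mul, inv_mul_cancel₀ hr.ne']
    rwa [← hcrange] at this
  let F : ℝ × ℝ → Fin 2 → ℝ := fun q => q.1 • (c q.2 - x₀)
  have hF : ContDiff ℝ (⊤ : ℕ∞) F :=
    contDiff_fst.smul ((hc.comp contDiff_snd).sub contDiff_const)
  have hFy : F (r, s) = y := by
    simp only [F, hs, add_sub_cancel_right, smul_smul, mul_inv_cancel₀ hr.ne', one_smul]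
  let L : ℝ × ℝ →L[ℝ] (Fin 2 → ℝ) :=
    (ContinuousLinearMap.fst ℝ ℝ ℝ).smulRight (c s - x₀) +
      (ContinuousLinearMap.snd ℝ ℝ ℝ).smulRight (r • deriv c s)
  have hL : HasFDerivAt F L (r, s) := by
    have h1 : HasFDerivAt (fun q : ℝ × ℝ => c q.2 - x₀)
        ((ContinuousLinearMap.snd ℝ ℝ ℝ).smulRight (deriv c s)) (r, s) := by
      have h2 : HasDerivAt c (deriv c s) ((r, s) : ℝ × ℝ).2 :=
        (hc.differentiable (by simp) s).hasDerivAt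
      have h3 := (h2.hasFDerivAt.comp (r, s) hasFDerivAt_snd).sub_const x₀
      refine h3.congr_fderiv ?_
      ext <;> simp
    refine (hasFDerivAt_fst.smul h1).congr_fderiv ?_
    ext <;> simp [L]
  have hpos : 0 < ∑ i, γ (c s) i * (c s i - x₀ i) :=
    normal_pos hΩo hγunit hγout (hcrange ▸ mem_range_self s) hx₀
  have hinj : Function.Injective L := by
    refine (injective_iff_map_eq_zero L).2 fun ⟨a, b⟩ hab => ?_
    have h0 : a * (c s 0 - x₀ 0) + b * (r * deriv c s 0) = 0 := by
      simpa [L] using congrFun hab 0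
    have h1 : a * (c s 1 - x₀ 1) + b * (r * deriv c s 1) = 0 := by
      simpa [L] using congrFun hab 1
    have hp := hperp s
    have hu := hcunit s
    simp only [Fin.sum_univ_two] at hp hu hpos
    have ha : a = 0 := by
      have : a * (γ (c s) 0 * (c s 0 - x₀ 0) + γ (c s) 1 * (c s 1 - x₀ 1)) = 0 := by
        linear_combination γ (c s) 0 * h0 + γ (c s) 1 * h1 - b * r * hp
      exact (mul_eq_zero.1 this).resolve_right hpos.ne'
    have hb : b = 0 := by
      have : b * r = 0 := by
        rw [ha] at h0 h1
        linear_combination deriv c s 0 * h0 + deriv c s 1 * h1 - b * r * hu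
      exact (mul_eq_zero.1 this).resolve_right hr.ne'
    simp [ha, hb]
  let e : (ℝ × ℝ) ≃L[ℝ] (Fin 2 → ℝ) :=
    (LinearEquiv.ofInjectiveOfFinrankEq (L : ℝ × ℝ →ₗ[ℝ] (Fin 2 → ℝ)) hinj
      (by simp)).toContinuousLinearEquiv
  have he : (e : ℝ × ℝ →L[ℝ] (Fin 2 → ℝ)) = L := by
    ext <;> rfl
  have hFe : HasFDerivAt F (e : ℝ × ℝ →L[ℝ] (Fin 2 → ℝ)) (r, s) := he ▸ hL
  have hFc : ContDiffAt ℝ (⊤ : ℕ∞) F (r, s) := hF.contDiffAt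
  have hinv := hFc.to_localInverse hFe (by simp)
  have hright : ∀ᶠ z in 𝓝 y, F (hFc.localInverse hFe (by simp) z) = z := by
    have := (hFc.hasStrictFDerivAt' hFe (by simp)).eventually_right_inverse
    rwa [hFy] at this
  rw [hFy] at hinv
  have hval : hFc.localInverse hFe (by simp) y = (r, s) := by
    have := hFc.localInverse_apply_image hFe (by simp)
    rwa [hFy] at this
  have hpos' : ∀ᶠ z in 𝓝 y, 0 < (hFc.localInverse hFe (by simp) z).1 := by
    refine (continuous_fst.continuousAt.comp hinv.continuousAt).eventually_mem
      (Ioi_mem_nhds ?_)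
    simpa [hval] using hr
  refine (contDiff_fst.contDiffAt.comp y hinv).congr_of_eventuallyEq ?_
  filter_upwards [hright, hpos'] with z hz hz'
  conv_lhs => rw [← hz]
  simp only [F, gauge_smul_of_nonneg hz'.le, hfr, smul_eq_mul, mul_one, Function.comp]

/-- A smooth function that is constant on the boundary and increasing in outward directions. -/
lemma exists_boundary_barrier (hΩo : IsOpen Ω) (hΩconv : Convex ℝ Ω)
    (hΩbd : Bornology.IsBounded Ω)
    (hγunit : ∀ x ∈ frontier Ω, ∑ i, (γ x i) ^ 2 = 1)
    (hγout : ∀ x ∈ frontier Ω, ∀ y ∈ Ω, ∑ i, γ x i * (y i - x i) ≤ 0)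
    (hc : ContDiff ℝ (⊤ : ℕ∞) c) (hcrange : range c = frontier Ω)
    (hcunit : ∀ s, ∑ i, (deriv c s i) ^ 2 = 1)
    (hperp : ∀ s, ∑ i, γ (c s) i * deriv c s i = 0)
    {x₀ : Fin 2 → ℝ} (hx₀ : x₀ ∈ Ω) :
    ∃ h : (Fin 2 → ℝ) → ℝ, ContDiff ℝ (⊤ : ℕ∞) h ∧ (∀ x ∈ frontier Ω, h x = 1) ∧
      ∀ x ∈ frontier Ω, fderiv ℝ h x (x - x₀) = 1 := by
  set D : Set (Fin 2 → ℝ) := (fun y => y + x₀) ⁻¹' Ω with hD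
  have hsm := fun y (hy : y ≠ 0) => contDiffAt_gauge_translate hΩo hΩconv hΩbd hγunit hγout hc
    hcrange hcunit hperp hx₀ hD hy
  have hDconv : Convex ℝ D := hΩconv.translate_preimage_left x₀
  have hD0 : D ∈ 𝓝 (0 : Fin 2 → ℝ) := by
    refine (hΩo.preimage (by fun_prop)).mem_nhds ?_
    simpa using hx₀
  let φ : ℝ → ℝ := fun r => r * Real.smoothTransition (4 * r - 1)
  have hφ : ContDiff ℝ (⊤ : ℕ∞) φ :=
    contDiff_id.mul (Real.smoothTransition.contDiff.comp (by fun_prop))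
  have hφ1 : ∀ r, 1 / 2 ≤ r → φ r = r := fun r hr => by
    simp only [φ]
    rw [Real.smoothTransition.one_of_one_le (by linarith), mul_one]
  have hφ0 : ∀ r, r ≤ 1 / 4 → φ r = 0 := fun r hr => by
    simp only [φ]
    rw [Real.smoothTransition.zero_of_nonpos (by linarith), mul_zero]
  have hgc : Continuous (gauge D) := continuous_gauge hDconv hD0
  have hfr : ∀ x ∈ frontier Ω, gauge D (x - x₀) = 1 := by
    intro x hx
    rw [gauge_eq_one_iff_mem_frontier hDconv hD0]
    have : D = (Homeomorph.addRight x₀) ⁻¹' Ω := hD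
    rw [this, ← Homeomorph.preimage_frontier]
    simpa using hx
  have hh : ContDiff ℝ (⊤ : ℕ∞) fun x => φ (gauge D (x - x₀)) := by
    have h1 : ContDiff ℝ (⊤ : ℕ∞) fun y => φ (gauge D y) := by
      refine contDiff_iff_contDiffAt.2 fun y => ?_
      by_cases hy : y = 0
      · have h2 : (fun y => φ (gauge D y)) =ᶠ[𝓝 y] fun _ => 0 := by
          have h3 : ∀ᶠ z in 𝓝 y, gauge D z < 1 / 4 := by
            refine hgc.continuousAt.eventually_lt continuousAt_const ?_
            rw [hy, gauge_zero]
            norm_num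
          filter_upwards [h3] with z hz using hφ0 _ hz.le
        exact contDiffAt_const.congr_of_eventuallyEq h2
      · exact hφ.contDiffAt.comp y (hsm y hy)
    exact h1.comp (contDiff_id.sub contDiff_const)
  refine ⟨_, hh, fun x hx => ?_, fun x hx => ?_⟩
  · rw [hfr x hx, hφ1 _ (by norm_num)]
  · have h1 := (hh.differentiable (by simp) x).hasFDerivAt
    have h2 : HasDerivAt (fun r : ℝ => x + r • (x - x₀)) (x - x₀) 0 := by
      have := ((hasDerivAt_id (0 : ℝ)).smul_const (x - x₀)).const_add x
      simpa using this
    have h3 := HasFDerivAt.comp_hasDerivAt (f := fun r : ℝ => x + r • (x - x₀)) (0 : ℝ)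
      (by simpa using h1) h2
    have h4 : HasDerivAt (fun r : ℝ => 1 + r) 1 0 := by
      simpa using (hasDerivAt_id (0 : ℝ)).const_add 1
    refine HasDerivAt.unique h3 (h4.congr_of_eventuallyEq ?_)
    filter_upwards [Ioi_mem_nhds (show (-(1 / 2) : ℝ) < 0 by norm_num)] with r hr
    have hr' : -(1 / 2) < r := hr
    have : x + r • (x - x₀) - x₀ = (1 + r) • (x - x₀) := by
      rw [add_smul, one_smul]; abel
    simp only [Function.comp, this]
    rw [gauge_smul_of_nonneg (by linarith), hfr x hx, smul_eq_mul, mul_one, hφ1 _ (by linarith)]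

end ConvexBoundary

section Cylinder

variable {Ω : Set (Fin 2 → ℝ)} {T : ℝ} {f g : (Fin 2 → ℝ) × ℝ → ℝ}

/-- The space-time cylinder `closure Ω × [0, T)`. -/
abbrev cylinder (Ω : Set (Fin 2 → ℝ)) (T : ℝ) : Set ((Fin 2 → ℝ) × ℝ) := closure Ω ×ˢ Ico 0 T

/-- The spatial coordinate directions of space-time. -/
abbrev spaceDir (i : Fin 2) : (Fin 2 → ℝ) × ℝ := (Pi.single i 1, 0)

/-- The time direction of space-time. -/
abbrev timeDir : (Fin 2 → ℝ) × ℝ := (0, 1)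

lemma uniqueDiffOn_closure (hΩo : IsOpen Ω) (hΩconv : Convex ℝ Ω) (hΩne : Ω.Nonempty) :
    UniqueDiffOn ℝ (closure Ω) :=
  uniqueDiffOn_convex hΩconv.closure (hΩne.mono (interior_maximal subset_closure hΩo))

lemma uniqueDiffOn_cylinder (hΩo : IsOpen Ω) (hΩconv : Convex ℝ Ω) (hΩne : Ω.Nonempty) :
    UniqueDiffOn ℝ (cylinder Ω T) :=
  (uniqueDiffOn_closure hΩo hΩconv hΩne).prod (uniqueDiffOn_Ico 0 T)

lemma cylinder_subset_closure : cylinder Ω T ⊆ closure (Ω ×ˢ Ioo 0 T) := by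
  rintro ⟨x, t⟩ ⟨hx, ht⟩
  have hT : (0 : ℝ) < T := ht.1.trans_lt ht.2
  rw [closure_prod_eq, closure_Ioo hT.ne]
  exact ⟨hx, Ico_subset_Icc_self ht⟩

lemma cylinder_subset_closure_interior (hΩo : IsOpen Ω) :
    cylinder Ω T ⊆ closure (interior (cylinder Ω T)) := by
  refine cylinder_subset_closure.trans (closure_mono ?_)
  exact interior_maximal (prod_mono subset_closure Ioo_subset_Ico_self) (hΩo.prod isOpen_Ioo)

lemma fderivWithin_slice (hΩo : IsOpen Ω) (hΩconv : Convex ℝ Ω) (hΩne : Ω.Nonempty)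
    (hf : ContDiffOn ℝ (⊤ : ℕ∞) f (cylinder Ω T)) {x : Fin 2 → ℝ} {t : ℝ}
    (hx : x ∈ closure Ω) (ht : t ∈ Ico 0 T) (d : Fin 2 → ℝ) :
    fderivWithin ℝ (fun y => f (y, t)) (closure Ω) x d
      = dirDeriv (cylinder Ω T) (d, 0) f (x, t) := by
  have h1 := hf.hasFDerivWithinAt' (q := (x, t)) ⟨hx, ht⟩
  have h2 : HasFDerivWithinAt (fun y : Fin 2 → ℝ => (y, t))
      (ContinuousLinearMap.inl ℝ (Fin 2 → ℝ) ℝ) (closure Ω) x :=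
    (hasFDerivAt_prodMk_left x t).hasFDerivWithinAt
  have h3 := HasFDerivWithinAt.comp (t := cylinder Ω T) x h1 h2 (fun y hy => ⟨hy, ht⟩)
  have h4 := h3.fderivWithin (uniqueDiffOn_closure hΩo hΩconv hΩne x hx)
  have h5 : (f ∘ fun y : Fin 2 → ℝ => (y, t)) = fun y => f (y, t) := rfl
  rw [h5] at h4
  rw [h4]
  rfl

lemma hasDerivWithinAt_time_slice (hf : ContDiffOn ℝ (⊤ : ℕ∞) f (cylinder Ω T))
    {x : Fin 2 → ℝ} {t : ℝ} (hx : x ∈ closure Ω) (ht : t ∈ Ico 0 T) :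
    HasDerivWithinAt (fun s => f (x, s)) (dirDeriv (cylinder Ω T) timeDir f (x, t)) (Ico 0 T) t := by
  have h1 := hf.hasFDerivWithinAt' (q := (x, t)) ⟨hx, ht⟩
  have h2 : HasDerivWithinAt (fun s : ℝ => (x, s)) ((0 : Fin 2 → ℝ), (1 : ℝ)) (Ico 0 T) t :=
    ((hasDerivAt_const t x).prodMk (hasDerivAt_id t)).hasDerivWithinAt
  exact HasFDerivWithinAt.comp_hasDerivWithinAt (t := cylinder Ω T) t h1 h2
    (fun s hs => ⟨hx, hs⟩)

lemma hasDerivAt_curve (hf : ContDiffOn ℝ (⊤ : ℕ∞) f (cylinder Ω T)) {c : ℝ → Fin 2 → ℝ}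
    {c' : Fin 2 → ℝ} {s t : ℝ} (hc : HasDerivAt c c' s) (hmem : ∀ᶠ r in 𝓝 s, c r ∈ closure Ω)
    (ht : t ∈ Ico 0 T) :
    HasDerivAt (fun r => f (c r, t)) (dirDeriv (cylinder Ω T) (c', 0) f (c s, t)) s := by
  have h1 := hf.hasFDerivWithinAt' (q := (c s, t)) ⟨hmem.self_of_nhds, ht⟩
  exact HasFDerivWithinAt.comp_hasDerivAt (t := cylinder Ω T) s h1
    (hc.prodMk (hasDerivAt_const s t)) (hmem.mono fun r hr => ⟨hr, ht⟩)

lemma dirDeriv_space (d : Fin 2 → ℝ) (q : (Fin 2 → ℝ) × ℝ) (S : Set ((Fin 2 → ℝ) × ℝ)) :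
    dirDeriv S (d, 0) f q
      = d 0 * dirDeriv S (spaceDir 0) f q + d 1 * dirDeriv S (spaceDir 1) f q := by
  have : ((d, 0) : (Fin 2 → ℝ) × ℝ) = d 0 • spaceDir 0 + d 1 • spaceDir 1 := by
    refine Prod.ext ?_ (by simp)
    ext i
    fin_cases i <;> simp
  rw [this, dirDeriv_add_dir, dirDeriv_smul_dir, dirDeriv_smul_dir]

lemma dirDeriv_space_space {S : Set ((Fin 2 → ℝ) × ℝ)} (hS : UniqueDiffOn ℝ S)
    (hcl : S ⊆ closure (interior S)) (hf : ContDiffOn ℝ (⊤ : ℕ∞) f S) (d : Fin 2 → ℝ)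
    {q : (Fin 2 → ℝ) × ℝ} (hq : q ∈ S) :
    dirDeriv S (d, 0) (dirDeriv S (d, 0) f) q
      = d 0 ^ 2 * dirDeriv S (spaceDir 0) (dirDeriv S (spaceDir 0) f) q
        + 2 * d 0 * d 1 * dirDeriv S (spaceDir 0) (dirDeriv S (spaceDir 1) f) q
        + d 1 ^ 2 * dirDeriv S (spaceDir 1) (dirDeriv S (spaceDir 1) f) q := by
  have h0 := (hf.dirDeriv hS (spaceDir 0)).hasFDerivWithinAt' hq
  have h1 := (hf.dirDeriv hS (spaceDir 1)).hasFDerivWithinAt' hq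
  have h : dirDeriv S (d, 0) f
      = fun z => d 0 * dirDeriv S (spaceDir 0) f z + d 1 * dirDeriv S (spaceDir 1) f z :=
    funext fun z => dirDeriv_space d z S
  have h2 := ((h0.const_mul (d 0)).add (h1.const_mul (d 1))).dirDeriv_eq hS hq
  have h3 : ∀ e, dirDeriv S e (dirDeriv S (d, 0) f) q
      = d 0 * dirDeriv S e (dirDeriv S (spaceDir 0) f) q
        + d 1 * dirDeriv S e (dirDeriv S (spaceDir 1) f) q := fun e => by
    rw [h]; exact h2 e
  rw [dirDeriv_space d q S, h3, h3,
    dirDeriv_comm hf hS hcl (spaceDir 1) (spaceDir 0) hq]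
  ring

/-- Necessary conditions at a maximum point of a smooth function on `closure Ω × [0, t₁]`. -/
lemma exists_max_cylinder (hΩo : IsOpen Ω) (hΩconv : Convex ℝ Ω)
    (hΩbd : Bornology.IsBounded Ω) (hΩne : Ω.Nonempty)
    {c : ℝ → Fin 2 → ℝ} (hc : Differentiable ℝ c) (hcrange : range c = frontier Ω)
    (hf : ContDiffOn ℝ (⊤ : ℕ∞) f (cylinder Ω T)) {t₁ : ℝ} (ht₁ : t₁ ∈ Ico 0 T) :
    ∃ z ∈ closure Ω, ∃ t ∈ Icc 0 t₁,
      (∀ x ∈ closure Ω, ∀ s ∈ Icc 0 t₁, f (x, s) ≤ f (z, t)) ∧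
      (0 < t → 0 ≤ dirDeriv (cylinder Ω T) timeDir f (z, t)) ∧
      (z ∈ Ω → ∀ d, dirDeriv (cylinder Ω T) (d, 0) f (z, t) = 0 ∧
        dirDeriv (cylinder Ω T) (d, 0) (dirDeriv (cylinder Ω T) (d, 0) f) (z, t) ≤ 0) ∧
      (∀ s, c s = z → dirDeriv (cylinder Ω T) (deriv c s, 0) f (z, t) = 0) ∧
      (∀ x₀ ∈ Ω, 0 ≤ dirDeriv (cylinder Ω T) (z - x₀, 0) f (z, t)) := by
  have hS := uniqueDiffOn_cylinder (T := T) hΩo hΩconv hΩne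
  set A : Set ((Fin 2 → ℝ) × ℝ) := closure Ω ×ˢ Icc 0 t₁ with hA
  have hAS : A ⊆ cylinder Ω T :=
    prod_mono subset_rfl (fun s hs => ⟨hs.1, hs.2.trans_lt ht₁.2⟩)
  have hAc : IsCompact A := hΩbd.isCompact_closure.prod isCompact_Icc
  have hAconv : Convex ℝ A := hΩconv.closure.prod (convex_Icc 0 t₁)
  have hAne : A.Nonempty := hΩne.closure.prod ⟨0, le_rfl, ht₁.1⟩
  obtain ⟨⟨z, t⟩, hzt, hmax⟩ := hAc.exists_isMaxOn hAne (hf.continuousOn.mono hAS)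
  have hz : z ∈ closure Ω := hzt.1
  have ht : t ∈ Icc 0 t₁ := hzt.2
  have htT : t ∈ Ico 0 T := (hAS hzt).2
  have hfd : HasFDerivWithinAt f (fderivWithin ℝ f (cylinder Ω T) (z, t)) A (z, t) :=
    (hf.hasFDerivWithinAt' (hAS hzt)).mono hAS
  have hcone : ∀ y ∈ A, dirDeriv (cylinder Ω T) (y - (z, t)) f (z, t) ≤ 0 := by
    intro y hy
    refine hmax.localize.hasFDerivWithinAt_nonpos hfd (mem_posTangentConeAt_of_segment_subset ?_)
    rw [add_sub_cancel]
    exact hAconv.segment_subset hzt hy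
  have hcurve : ∀ (k : ℝ → Fin 2 → ℝ) (s : ℝ), k s = z → (∀ᶠ r in 𝓝 s, k r ∈ closure Ω) →
      IsLocalMax (fun r => f (k r, t)) s := by
    intro k s hks hmem
    filter_upwards [hmem] with r hr
    rw [hks]
    exact hmax (show (k r, t) ∈ A from ⟨hr, ht⟩)
  refine ⟨z, hz, t, ht, fun x hx s hs => hmax (show (x, s) ∈ A from ⟨hx, hs⟩), ?_, ?_, ?_, ?_⟩
  · intro ht0
    have h1 := hcone (z, 0) ⟨hz, le_rfl, ht₁.1⟩
    have h2 : ((z, (0 : ℝ)) - (z, t) : (Fin 2 → ℝ) × ℝ) = (-t) • timeDir := by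
      ext <;> simp
    rw [h2, dirDeriv_smul_dir] at h1
    by_contra! h3
    nlinarith
  · intro hzΩ d
    let k : ℝ → Fin 2 → ℝ := fun r => z + r • d
    have hk : ∀ r, HasDerivAt k d r := fun r => by
      have h := ((hasDerivAt_id r).smul_const d).const_add z
      rwa [one_smul] at h
    have hk0 : k 0 = z := by simp [k]
    have hev : ∀ᶠ r in 𝓝 (0 : ℝ), k r ∈ Ω :=
      (hk 0).continuousAt.eventually_mem (hΩo.mem_nhds (by rwa [hk0]))
    have hev' : ∀ᶠ r in 𝓝 (0 : ℝ), ∀ᶠ r' in 𝓝 r, k r' ∈ closure Ω :=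
      (eventually_eventually_nhds.2 hev).mono fun r hr => hr.mono fun r' h => subset_closure h
    have hmaxk := hcurve k 0 hk0 hev'.self_of_nhds
    have hd1 : ∀ᶠ r in 𝓝 (0 : ℝ), HasDerivAt (fun r => f (k r, t))
        (dirDeriv (cylinder Ω T) (d, 0) f (k r, t)) r :=
      hev'.mono fun r hr => hasDerivAt_curve hf (hk r) hr htT
    have hd2 := hasDerivAt_curve (hf.dirDeriv hS (d, 0)) (hk 0) hev'.self_of_nhds htT
    have h1 := hmaxk.hasDerivAt_eq_zero hd1.self_of_nhds
    have h2 := hmaxk.second_deriv_nonpos hd1 hd2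
    rw [hk0] at h1 h2
    exact ⟨h1, h2⟩
  · intro s hs
    have hmem : ∀ᶠ r in 𝓝 s, c r ∈ closure Ω := Eventually.of_forall fun r =>
      frontier_subset_closure (hcrange ▸ mem_range_self r)
    have h1 := (hcurve c s hs hmem).hasDerivAt_eq_zero
      (hasDerivAt_curve hf (hc s).hasDerivAt hmem htT)
    rwa [hs] at h1
  · intro x₀ hx₀
    have h1 := hcone (x₀, t) ⟨subset_closure hx₀, ht⟩
    have h2 : ((x₀, t) - (z, t) : (Fin 2 → ℝ) × ℝ) = (-1 : ℝ) • ((z - x₀, 0) : (Fin 2 → ℝ) × ℝ) := by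
      ext <;> simp
    rw [h2, dirDeriv_smul_dir] at h1
    linarith

end Cylinder

section Equation

variable {Ω : Set (Fin 2 → ℝ)} {γ : (Fin 2 → ℝ) → Fin 2 → ℝ} {α : (Fin 2 → ℝ) → ℝ} {T : ℝ}
  {U : (Fin 2 → ℝ) × ℝ → ℝ}

/-- The spatial partial derivatives of a function on the cylinder. -/
def grad (Ω : Set (Fin 2 → ℝ)) (T : ℝ) (U : (Fin 2 → ℝ) × ℝ → ℝ) (i : Fin 2) :
    (Fin 2 → ℝ) × ℝ → ℝ := dirDeriv (cylinder Ω T) (spaceDir i) U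

/-- The second spatial partial derivatives of a function on the cylinder. -/
def hess (Ω : Set (Fin 2 → ℝ)) (T : ℝ) (U : (Fin 2 → ℝ) × ℝ → ℝ) (i j : Fin 2) :
    (Fin 2 → ℝ) × ℝ → ℝ := grad Ω T (grad Ω T U j) i

/-- The time derivative of a function on the cylinder. -/
def timeDeriv (Ω : Set (Fin 2 → ℝ)) (T : ℝ) (U : (Fin 2 → ℝ) × ℝ → ℝ) :
    (Fin 2 → ℝ) × ℝ → ℝ := dirDeriv (cylinder Ω T) timeDir U

/-- `1 - |DU|²`. -/
def lapseSq (Ω : Set (Fin 2 → ℝ)) (T : ℝ) (U : (Fin 2 → ℝ) × ℝ → ℝ) (q : (Fin 2 → ℝ) × ℝ) : ℝ :=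
  1 - (grad Ω T U 0 q ^ 2 + grad Ω T U 1 q ^ 2)

/-- The operator `(1 - |DU|²) Δf + D²f(DU, DU)`, the principal part of the equation. -/
def principalPart (Ω : Set (Fin 2 → ℝ)) (T : ℝ) (U f : (Fin 2 → ℝ) × ℝ → ℝ)
    (q : (Fin 2 → ℝ) × ℝ) : ℝ :=
  lapseSq Ω T U q * (hess Ω T f 0 0 q + hess Ω T f 1 1 q)
    + (grad Ω T U 0 q ^ 2 * hess Ω T f 0 0 q
      + 2 * grad Ω T U 0 q * grad Ω T U 1 q * hess Ω T f 0 1 q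
      + grad Ω T U 1 q ^ 2 * hess Ω T f 1 1 q)

/-- Graphical spacelike mean curvature flow in non-divergence form, up to the boundary. -/
structure IsFlow (Ω : Set (Fin 2 → ℝ)) (γ : (Fin 2 → ℝ) → Fin 2 → ℝ) (α : (Fin 2 → ℝ) → ℝ)
    (T : ℝ) (U : (Fin 2 → ℝ) × ℝ → ℝ) : Prop where
  smooth : ContDiffOn ℝ (⊤ : ℕ∞) U (cylinder Ω T)
  lapseSq_pos : ∀ q ∈ cylinder Ω T, 0 < lapseSq Ω T U q
  pde : ∀ q ∈ cylinder Ω T, lapseSq Ω T U q * timeDeriv Ω T U q = principalPart Ω T U U q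
  neumann : ∀ x ∈ frontier Ω, ∀ t ∈ Ico 0 T,
    γ x 0 * grad Ω T U 0 (x, t) + γ x 1 * grad Ω T U 1 (x, t) = α x * √(lapseSq Ω T U (x, t))

variable {f : (Fin 2 → ℝ) × ℝ → ℝ}

lemma ContDiffOn.grad (hS : UniqueDiffOn ℝ (cylinder Ω T))
    (hf : ContDiffOn ℝ (⊤ : ℕ∞) f (cylinder Ω T)) (i : Fin 2) :
    ContDiffOn ℝ (⊤ : ℕ∞) (grad Ω T f i) (cylinder Ω T) := hf.dirDeriv hS _

lemma ContDiffOn.hess (hS : UniqueDiffOn ℝ (cylinder Ω T))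
    (hf : ContDiffOn ℝ (⊤ : ℕ∞) f (cylinder Ω T)) (i j : Fin 2) :
    ContDiffOn ℝ (⊤ : ℕ∞) (hess Ω T f i j) (cylinder Ω T) := (hf.grad hS j).grad hS i

lemma ContDiffOn.timeDeriv (hS : UniqueDiffOn ℝ (cylinder Ω T))
    (hf : ContDiffOn ℝ (⊤ : ℕ∞) f (cylinder Ω T)) :
    ContDiffOn ℝ (⊤ : ℕ∞) (timeDeriv Ω T f) (cylinder Ω T) := hf.dirDeriv hS _

lemma ContDiffOn.lapseSq (hS : UniqueDiffOn ℝ (cylinder Ω T))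
    (hf : ContDiffOn ℝ (⊤ : ℕ∞) f (cylinder Ω T)) :
    ContDiffOn ℝ (⊤ : ℕ∞) (lapseSq Ω T f) (cylinder Ω T) :=
  contDiffOn_const.sub (((hf.grad hS 0).pow 2).add ((hf.grad hS 1).pow 2))

lemma ContDiffOn.principalPart (hS : UniqueDiffOn ℝ (cylinder Ω T))
    (hU : ContDiffOn ℝ (⊤ : ℕ∞) U (cylinder Ω T))
    (hf : ContDiffOn ℝ (⊤ : ℕ∞) f (cylinder Ω T)) :
    ContDiffOn ℝ (⊤ : ℕ∞) (principalPart Ω T U f) (cylinder Ω T) :=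
  ((hU.lapseSq hS).mul ((hf.hess hS 0 0).add (hf.hess hS 1 1))).add
    (((((hU.grad hS 0).pow 2).mul (hf.hess hS 0 0)).add
      (((contDiffOn_const.mul (hU.grad hS 0)).mul (hU.grad hS 1)).mul (hf.hess hS 0 1))).add
      (((hU.grad hS 1).pow 2).mul (hf.hess hS 1 1)))

lemma hess_symm (hΩo : IsOpen Ω) (hS : UniqueDiffOn ℝ (cylinder Ω T))
    (hf : ContDiffOn ℝ (⊤ : ℕ∞) f (cylinder Ω T)) {q : (Fin 2 → ℝ) × ℝ} (hq : q ∈ cylinder Ω T) :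
    hess Ω T f 1 0 q = hess Ω T f 0 1 q :=
  dirDeriv_comm hf hS (cylinder_subset_closure_interior hΩo) _ _ hq

lemma dirDeriv_lapseSq (hS : UniqueDiffOn ℝ (cylinder Ω T))
    (hU : ContDiffOn ℝ (⊤ : ℕ∞) U (cylinder Ω T)) {q : (Fin 2 → ℝ) × ℝ}
    (hq : q ∈ cylinder Ω T) (d : (Fin 2 → ℝ) × ℝ) :
    dirDeriv (cylinder Ω T) d (lapseSq Ω T U) q
      = -(2 * (grad Ω T U 0 q * dirDeriv (cylinder Ω T) d (grad Ω T U 0) q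
        + grad Ω T U 1 q * dirDeriv (cylinder Ω T) d (grad Ω T U 1) q)) := by
  have h0 := (hU.grad hS 0).hasFDerivWithinAt' hq
  have h1 := (hU.grad hS 1).hasFDerivWithinAt' hq
  have h2 := (((h0.pow 2).add (h1.pow 2)).const_sub 1).dirDeriv_eq hS hq d
  refine Eq.trans h2 ?_
  simp [dirDeriv]
  ring

/-- The flow equation differentiated in an arbitrary space-time direction. -/
lemma IsFlow.dirDeriv_pde (hS : UniqueDiffOn ℝ (cylinder Ω T)) (hU : IsFlow Ω γ α T U)
    {q : (Fin 2 → ℝ) × ℝ} (hq : q ∈ cylinder Ω T) {d : (Fin 2 → ℝ) × ℝ}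
    {D : ((Fin 2 → ℝ) × ℝ → ℝ) → ℝ} (hD : D = fun f => dirDeriv (cylinder Ω T) d f q) :
    lapseSq Ω T U q * D (timeDeriv Ω T U)
      = 2 * (grad Ω T U 0 q * D (grad Ω T U 0) + grad Ω T U 1 q * D (grad Ω T U 1))
          * (timeDeriv Ω T U q - (hess Ω T U 0 0 q + hess Ω T U 1 1 q))
        + (lapseSq Ω T U q * (D (hess Ω T U 0 0) + D (hess Ω T U 1 1))
          + (grad Ω T U 0 q ^ 2 * D (hess Ω T U 0 0)
            + 2 * grad Ω T U 0 q * grad Ω T U 1 q * D (hess Ω T U 0 1)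
            + grad Ω T U 1 q ^ 2 * D (hess Ω T U 1 1)))
        + 2 * (grad Ω T U 0 q * D (grad Ω T U 0) * hess Ω T U 0 0 q
          + (grad Ω T U 0 q * D (grad Ω T U 1) + grad Ω T U 1 q * D (grad Ω T U 0))
            * hess Ω T U 0 1 q
          + grad Ω T U 1 q * D (grad Ω T U 1) * hess Ω T U 1 1 q) := by
  have h0 := (hU.smooth.grad hS 0).hasFDerivWithinAt' hq
  have h1 := (hU.smooth.grad hS 1).hasFDerivWithinAt' hq
  have hz := (hU.smooth.lapseSq hS).hasFDerivWithinAt' hq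
  have hw := (hU.smooth.timeDeriv hS).hasFDerivWithinAt' hq
  have h00 := (hU.smooth.hess hS 0 0).hasFDerivWithinAt' hq
  have h01 := (hU.smooth.hess hS 0 1).hasFDerivWithinAt' hq
  have h11 := (hU.smooth.hess hS 1 1).hasFDerivWithinAt' hq
  have hl := (hz.mul hw).dirDeriv_eq hS hq d
  have hr := ((hz.mul (h00.add h11)).add ((((h0.pow 2).mul h00).add
    (((h0.const_mul 2).mul h1).mul h01)).add ((h1.pow 2).mul h11))).dirDeriv_eq hS hq d
  have heq := dirDeriv_congr hU.pde d hq
  have key := hl.symm.trans (heq.trans hr)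
  have hzd := dirDeriv_lapseSq hS hU.smooth hq d
  subst hD
  simp only [dirDeriv] at hzd ⊢
  simp at key
  rw [hzd] at key
  linear_combination key

lemma IsGraphMCF.isFlow (hΩo : IsOpen Ω) (hΩconv : Convex ℝ Ω) (hΩne : Ω.Nonempty)
    {u : (Fin 2 → ℝ) → ℝ → ℝ} (hu : IsGraphMCF Ω γ α (Ico 0 T) u) :
    IsFlow Ω γ α T (fun q => u q.1 q.2) ∧
      (∀ x ∈ closure Ω, ∀ t ∈ Ico 0 T,
        1 - spGradSq Ω u x t = lapseSq Ω T (fun q => u q.1 q.2) (x, t)) ∧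
      (∀ x ∈ closure Ω, ∀ t ∈ Ico 0 T,
        derivWithin (fun s => u x s) (Ico 0 T) t
          = timeDeriv Ω T (fun q => u q.1 q.2) (x, t)) := by
  set U : (Fin 2 → ℝ) × ℝ → ℝ := fun q => u q.1 q.2 with hUdef
  have hS := uniqueDiffOn_cylinder (T := T) hΩo hΩconv hΩne
  have hUs : ContDiffOn ℝ (⊤ : ℕ∞) U (cylinder Ω T) := hu.smooth
  have hgrad : ∀ x ∈ closure Ω, ∀ t ∈ Ico 0 T, ∀ i, spGrad Ω u x t i = grad Ω T U i (x, t) :=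
    fun x hx t ht i => fderivWithin_slice hΩo hΩconv hΩne hUs hx ht _
  have hsq : ∀ x ∈ closure Ω, ∀ t ∈ Ico 0 T, 1 - spGradSq Ω u x t = lapseSq Ω T U (x, t) := by
    intro x hx t ht
    simp only [spGradSq, Fin.sum_univ_two, hgrad x hx t ht, lapseSq]
  have htime : ∀ x ∈ closure Ω, ∀ t ∈ Ico 0 T,
      derivWithin (fun s => u x s) (Ico 0 T) t = timeDeriv Ω T U (x, t) :=
    fun x hx t ht =>
      (hasDerivWithinAt_time_slice hUs hx ht).derivWithin (uniqueDiffOn_Ico 0 T t ht)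
  have hpos : ∀ q ∈ cylinder Ω T, 0 < lapseSq Ω T U q := by
    rintro ⟨x, t⟩ ⟨hx, ht⟩
    have := hu.spacelike x hx t ht
    rw [← hsq x hx t ht]
    linarith
  have hsqrt : ContDiffOn ℝ (⊤ : ℕ∞) (fun q => √(lapseSq Ω T U q)) (cylinder Ω T) :=
    (hUs.lapseSq hS).sqrt fun q hq => (hpos q hq).ne'
  have hquot : ∀ i, ContDiffOn ℝ (⊤ : ℕ∞) (fun q => grad Ω T U i q / √(lapseSq Ω T U q))
      (cylinder Ω T) := fun i =>
    (hUs.grad hS i).div hsqrt fun q hq => (Real.sqrt_pos.2 (hpos q hq)).ne'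
  have hpde : ∀ q ∈ Ω ×ˢ Ico 0 T,
      lapseSq Ω T U q * timeDeriv Ω T U q = principalPart Ω T U U q := by
    rintro ⟨x, t⟩ ⟨hxΩ, ht⟩
    have hx := subset_closure hxΩ
    have hq : (x, t) ∈ cylinder Ω T := ⟨hx, ht⟩
    have hW := Real.sqrt_pos.2 (hpos _ hq)
    have hterm : ∀ i, fderivWithin ℝ
        (fun y => spGrad Ω u y t i / √(1 - spGradSq Ω u y t)) (closure Ω) x (Pi.single i 1)
        = hess Ω T U i i (x, t) / √(lapseSq Ω T U (x, t))
          - grad Ω T U i (x, t) * grad Ω T (lapseSq Ω T U) i (x, t)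
            / (2 * √(lapseSq Ω T U (x, t)) * lapseSq Ω T U (x, t)) := by
      intro i
      have h1 : EqOn (fun y => spGrad Ω u y t i / √(1 - spGradSq Ω u y t))
          (fun y => (fun q => grad Ω T U i q / √(lapseSq Ω T U q)) (y, t)) (closure Ω) := by
        intro y hy
        simp only [hgrad y hy t ht, hsq y hy t ht]
      rw [fderivWithin_congr h1 (h1 hx), fderivWithin_slice hΩo hΩconv hΩne (hquot i) hx ht]
      have hg := (hUs.grad hS i).hasFDerivWithinAt' hq
      have hz := ((hUs.lapseSq hS).hasFDerivWithinAt' hq).sqrt (hpos _ hq).ne'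
      have hinv := HasDerivAt.comp_hasFDerivWithinAt
        (f := fun q => √(lapseSq Ω T U q)) (x, t) (hasDerivAt_inv hW.ne') hz
      have h2 := (hg.mul hinv).dirDeriv_eq hS hq (spaceDir i)
      refine Eq.trans (congrFun (congrArg _ ?_) _) (h2.trans ?_)
      · funext q
        simp [div_eq_mul_inv]
      · have hW2 := Real.sq_sqrt (hpos _ hq).le
        simp only [hess, grad, dirDeriv]
        simp
        rw [hW2]
        have := hpos _ hq
        field_simp
        ring
    have h := hu.pde x hxΩ t ht
    rw [htime x hx t ht, hsq x hx t ht, Fin.sum_univ_two, hterm, hterm] at h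
    have hl0 := dirDeriv_lapseSq hS hUs hq (spaceDir 0)
    have hl1 := dirDeriv_lapseSq hS hUs hq (spaceDir 1)
    have hsym := hess_symm hΩo hS hUs hq
    change grad Ω T (lapseSq Ω T U) 0 (x, t) = -(2 * (grad Ω T U 0 (x, t) * hess Ω T U 0 0 (x, t)
      + grad Ω T U 1 (x, t) * hess Ω T U 0 1 (x, t))) at hl0
    change grad Ω T (lapseSq Ω T U) 1 (x, t) = -(2 * (grad Ω T U 0 (x, t) * hess Ω T U 1 0 (x, t)
      + grad Ω T U 1 (x, t) * hess Ω T U 1 1 (x, t))) at hl1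
    rw [hl0, hl1, hsym] at h
    have hz := hpos _ hq
    rw [h, principalPart]
    field_simp
    ring
  refine ⟨⟨hUs, hpos, ?_, ?_⟩, hsq, htime⟩
  · have hcont1 := ((hUs.lapseSq hS).mul (hUs.timeDeriv hS)).continuousOn
    have hcont2 := (hUs.principalPart hS hUs).continuousOn
    have hE : EqOn (fun q => lapseSq Ω T U q * timeDeriv Ω T U q) (principalPart Ω T U U)
        (Ω ×ˢ Ico 0 T) := hpde
    refine hE.of_subset_closure hcont1 hcont2 (prod_mono subset_closure subset_rfl) ?_
    exact cylinder_subset_closure.trans (closure_mono (prod_mono subset_rfl Ioo_subset_Ico_self))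
  · intro x hx t ht
    have hx' := frontier_subset_closure hx
    have h := hu.neumann x hx t ht
    simpa only [Fin.sum_univ_two, hgrad x hx' t ht, hsq x hx' t ht] using h

end Equation

section BoundaryAlgebra

/-- The first- and second-order conditions at a boundary point where `|DU|²` is maximal,
combined in the frame formed by the normal `g` and the tangent `τ`. -/
lemma boundary_frame_inequality {g τ : Fin 2 → ℝ} (hg : ∑ i, (g i) ^ 2 = 1)
    (hτ : ∑ i, (τ i) ^ 2 = 1) (hgτ : ∑ i, g i * τ i = 0)
    {p₀ p₁ h₀₀ h₀₁ h₁₁ W w a a' κ b : ℝ} (hWpos : 0 < W) (hW : W ^ 2 = 1 - (p₀ ^ 2 + p₁ ^ 2))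
    (hb : b = τ 0 * p₀ + τ 1 * p₁) (hn : g 0 * p₀ + g 1 * p₁ = a * W)
    (htan : p₀ * (τ 0 * h₀₀ + τ 1 * h₀₁) + p₁ * (τ 0 * h₀₁ + τ 1 * h₁₁) = 0)
    (hnor : 0 ≤ p₀ * (g 0 * h₀₀ + g 1 * h₀₁) + p₁ * (g 0 * h₀₁ + g 1 * h₁₁))
    (hbc : κ * b + g 0 * (τ 0 * h₀₀ + τ 1 * h₀₁) + g 1 * (τ 0 * h₀₁ + τ 1 * h₁₁) = a' * W)
    (hpde : W ^ 2 * w = W ^ 2 * (h₀₀ + h₁₁)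
      + (p₀ ^ 2 * h₀₀ + 2 * p₀ * p₁ * h₀₁ + p₁ ^ 2 * h₁₁)) :
    b ^ 2 = 1 - (1 + a ^ 2) * W ^ 2 ∧
      0 ≤ a * W * w * b ^ 2 + (1 - W ^ 2) * (a' * W * b - κ * b ^ 2) := by
  have hdec := frame_decomp hg hτ hgτ ![p₀, p₁]
  have hcases := frame_cases hg hτ hgτ
  have hp0 : p₀ = a * W * g 0 + b * τ 0 := by
    have := congrFun hdec 0
    simp [Fin.sum_univ_two] at this
    rw [hn, ← hb] at this
    exact this
  have hp1 : p₁ = a * W * g 1 + b * τ 1 := by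
    have := congrFun hdec 1
    simp [Fin.sum_univ_two] at this
    rw [hn, ← hb] at this
    exact this
  simp only [Fin.sum_univ_two] at hg hτ hgτ
  have hb2 : b ^ 2 = 1 - (1 + a ^ 2) * W ^ 2 := by
    have : p₀ ^ 2 + p₁ ^ 2 = a ^ 2 * W ^ 2 + b ^ 2 := by
      rw [hp0, hp1]
      linear_combination a ^ 2 * W ^ 2 * hg + b ^ 2 * hτ + 2 * a * W * b * hgτ
    linear_combination hW - this
  refine ⟨hb2, ?_⟩
  obtain ⟨A, hA⟩ : ∃ A, A = g 0 ^ 2 * h₀₀ + 2 * g 0 * g 1 * h₀₁ + g 1 ^ 2 * h₁₁ := ⟨_, rfl⟩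
  obtain ⟨e, he⟩ : ∃ e, e = g 0 * (τ 0 * h₀₀ + τ 1 * h₀₁) + g 1 * (τ 0 * h₀₁ + τ 1 * h₁₁) :=
    ⟨_, rfl⟩
  obtain ⟨d, hd⟩ : ∃ d, d = τ 0 ^ 2 * h₀₀ + 2 * τ 0 * τ 1 * h₀₁ + τ 1 ^ 2 * h₁₁ := ⟨_, rfl⟩
  obtain ⟨N, hN⟩ : ∃ N, N = p₀ * (g 0 * h₀₀ + g 1 * h₀₁) + p₁ * (g 0 * h₀₁ + g 1 * h₁₁) :=
    ⟨_, rfl⟩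
  have hN' : N = a * W * A + b * e := by
    rw [hN, hA, he, hp0, hp1]; ring
  have htan' : a * W * e + b * d = 0 := by
    rw [← htan, he, hd, hp0, hp1]; ring
  have hbc' : κ * b + e = a' * W := by
    rw [← hbc, he]; ring
  have htr : h₀₀ + h₁₁ = A + d := by
    rw [hA, hd]
    rcases hcases with ⟨h0, h1⟩ | ⟨h0, h1⟩ <;> rw [h0, h1] <;>
      linear_combination -(h₀₀ + h₁₁) * hg
  have hquad : p₀ ^ 2 * h₀₀ + 2 * p₀ * p₁ * h₀₁ + p₁ ^ 2 * h₁₁ = a * W * N := by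
    have : p₀ ^ 2 * h₀₀ + 2 * p₀ * p₁ * h₀₁ + p₁ ^ 2 * h₁₁
        = a * W * (a * W * A + b * e) + b * (a * W * e + b * d) := by
      rw [hA, he, hd, hp0, hp1]; ring
    rw [this, htan', hN']; ring
  rw [htr, hquad] at hpde
  have hpde' : W * w = W * (A + d) + a * N := by
    have : W * (W * w) = W * (W * (A + d) + a * N) := by linear_combination hpde
    exact mul_left_cancel₀ hWpos.ne' this
  have h1 : (1 + a ^ 2) * N = a * W * w + b * e - a * W * d := by
    linear_combination -a * hpde' + hN'
  have h2 : (1 + a ^ 2) * N * b ^ 2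
      = a * W * w * b ^ 2 + (1 - W ^ 2) * (a' * W * b - κ * b ^ 2) := by
    linear_combination b ^ 2 * h1 - a * W * b * htan' + b * e * hb2 + (1 - W ^ 2) * b * hbc'
  rw [← h2]
  rw [← hN] at hnor
  positivity

/-- The elementary inequality behind the choice of the constant in the gradient estimate. -/
lemma one_le_of_frame_inequality {X Y W m β : ℝ} (hWpos : 0 < W) (hX0 : 0 ≤ X) (hY0 : 0 ≤ Y)
    (hm1 : 1 ≤ m) (hmW : 4 * m * W ^ 2 ≤ 1) (hβpos : 0 < β) (hs : 1 - m * W ^ 2 ≤ β ^ 2)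
    (hmain : β * (1 - W ^ 2) ≤ X * β + (1 - W ^ 2) * Y) :
    1 ≤ m * X + m * (2 * m - 1) * Y + m * W := by
  by_contra! hsum
  have hW4 : W ^ 2 ≤ 1 / 4 := by
    have : 1 * W ^ 2 ≤ m * W ^ 2 := by gcongr
    linarith
  have hW2 : W ≤ 1 / 2 := abs_le_of_sq_le_sq' (by linarith) (by norm_num) |>.2
  have h1W : 0 < 1 - W ^ 2 := by linarith
  have hmY : m * Y ≤ m * (2 * m - 1) * Y := by
    have : m * Y * 1 ≤ m * Y * (2 * m - 1) := by gcongr; linarith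
    linarith
  have hmX : X ≤ m * X := le_mul_of_one_le_left hX0 hm1
  have hmY' : Y ≤ m * Y := le_mul_of_one_le_left hY0 hm1
  have hmW' : W ≤ m * W := le_mul_of_one_le_left hWpos.le hm1
  have hX1 : X ≤ 1 := by linarith
  have hmY1 : m * Y ≤ 1 := by linarith
  have hXq : X ≤ (X + 2 / 3 * W) * (1 - W ^ 2) := by
    have e1 : X * W ≤ 1 * (1 / 2) := by gcongr
    have e2 := mul_nonneg hWpos.le (sub_nonneg.2 e1)
    have e3 := mul_nonneg hWpos.le (sub_nonneg.2 hW4)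
    linarith
  have hβinv : 1 ≤ (1 + 2 / 3 * (m * W ^ 2)) * β := by
    obtain ⟨s, hs'⟩ : ∃ s, s = m * W ^ 2 := ⟨_, rfl⟩
    have hs0 : 0 ≤ s := by rw [hs']; positivity
    have hs4 : s ≤ 1 / 4 := by rw [hs']; linarith
    rw [← hs'] at hs ⊢
    have e1 : 1 ≤ ((1 + 2 / 3 * s) * β) ^ 2 := by
      have e2 : 1 ≤ (1 + 2 / 3 * s) ^ 2 * (1 - s) := by
        have e3 : 0 ≤ s * (1 / 3 - 8 / 9 * s - 4 / 9 * s ^ 2) := by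
          apply mul_nonneg hs0; nlinarith
        nlinarith
      calc 1 ≤ (1 + 2 / 3 * s) ^ 2 * (1 - s) := e2
        _ ≤ (1 + 2 / 3 * s) ^ 2 * β ^ 2 := by gcongr
        _ = _ := by ring
    have e4 : 0 ≤ (1 + 2 / 3 * s) * β := by positivity
    nlinarith
  have hYq : Y ≤ (Y + 1 / 3 * W) * β := by
    have e1 : Y * (1 + 2 / 3 * (m * W ^ 2)) ≤ Y + 1 / 3 * W := by
      have e2 : m * Y * (W * W) ≤ 1 * (1 / 2 * W) := by gcongr
      linarith
    calc Y = Y * 1 := by ring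
      _ ≤ Y * ((1 + 2 / 3 * (m * W ^ 2)) * β) := by gcongr
      _ = Y * (1 + 2 / 3 * (m * W ^ 2)) * β := by ring
      _ ≤ _ := by gcongr
  have hfin : β * (1 - W ^ 2) ≤ (X + Y + W) * (β * (1 - W ^ 2)) := by
    have e1 : X * β ≤ (X + 2 / 3 * W) * (1 - W ^ 2) * β := by gcongr
    have e2 : Y * (1 - W ^ 2) ≤ (Y + 1 / 3 * W) * β * (1 - W ^ 2) := by gcongr
    linarith
  have hprod : 0 < β * (1 - W ^ 2) := by positivity
  have := (le_mul_iff_one_le_left hprod).1 hfin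
  linarith

/-- A violation of the asserted bound contradicts the frame inequality. -/
lemma one_le_mul_of_frame_inequality {a a' w κ b W abar CH Cα κlow C : ℝ} (hWpos : 0 < W)
    (ha : |a| ≤ abar) (ha' : |a'| ≤ Cα) (hw : |w| ≤ CH) (hκlow : 0 < κlow) (hκ : κlow ≤ κ)
    (hb : b ^ 2 = 1 - (1 + a ^ 2) * W ^ 2)
    (hineq : 0 ≤ a * W * w * b ^ 2 + (1 - W ^ 2) * (a' * W * b - κ * b ^ 2))
    (hC1 : 2 * √(1 + abar ^ 2) ≤ C)
    (hC2 : (1 + abar ^ 2) * (κlow⁻¹ * abar * CH + κlow⁻¹ * (2 * abar ^ 2 + 1) * Cα + 1) ≤ C) :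
    1 ≤ C * W := by
  by_contra! hCW
  have habar : 0 ≤ abar := (abs_nonneg a).trans ha
  have hCH : 0 ≤ CH := (abs_nonneg w).trans hw
  have hCα : 0 ≤ Cα := (abs_nonneg a').trans ha'
  obtain ⟨m, hm⟩ : ∃ m, m = 1 + abar ^ 2 := ⟨_, rfl⟩
  have hm1 : 1 ≤ m := by rw [hm]; nlinarith
  have hCpos : 0 < C := lt_of_lt_of_le (by positivity) hC1
  have hmW : 4 * m * W ^ 2 ≤ 1 := by
    have h1 : (2 * √(1 + abar ^ 2)) ^ 2 = 4 * m := by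
      rw [mul_pow, Real.sq_sqrt (by positivity), hm]; norm_num
    have h2 : (2 * √(1 + abar ^ 2)) ^ 2 ≤ C ^ 2 := by gcongr
    have h3 : (C * W) ^ 2 ≤ 1 := by
      apply pow_le_one₀ (by positivity) hCW.le
    nlinarith [sq_nonneg W]
  have hW4 : W ^ 2 ≤ 1 / 4 := by nlinarith [sq_nonneg W]
  have ha2 : a ^ 2 ≤ abar ^ 2 := by
    rw [← sq_abs a]; gcongr
  obtain ⟨β, hβ⟩ : ∃ β, β = |b| := ⟨_, rfl⟩
  have hβ2 : β ^ 2 = b ^ 2 := by rw [hβ, sq_abs]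
  have hs : 1 - m * W ^ 2 ≤ β ^ 2 := by
    rw [hβ2, hb, hm]; nlinarith [sq_nonneg W]
  have hβpos : 0 < β := by
    have : 0 ≤ β := hβ ▸ abs_nonneg b
    rcases this.eq_or_lt with h | h
    · rw [← h] at hs; nlinarith
    · exact h
  obtain ⟨A, hA⟩ : ∃ A, A = κlow⁻¹ * abar * CH := ⟨_, rfl⟩
  obtain ⟨B, hB⟩ : ∃ B, B = κlow⁻¹ * Cα := ⟨_, rfl⟩
  have hA0 : 0 ≤ A := by rw [hA]; positivity
  have hB0 : 0 ≤ B := by rw [hB]; positivity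
  have hkA : κlow * A = abar * CH := by rw [hA]; field_simp
  have hkB : κlow * B = Cα := by rw [hB]; field_simp
  have hC3 : m * (A + (2 * m - 1) * B + 1) * W < 1 := by
    have : m * (A + (2 * m - 1) * B + 1) ≤ C := by
      refine le_trans (le_of_eq ?_) hC2
      rw [hA, hB, hm]; ring
    exact (mul_le_mul_of_nonneg_right this hWpos.le).trans_lt hCW
  have haw : a * w ≤ abar * CH := by
    calc a * w ≤ |a * w| := le_abs_self _
      _ = |a| * |w| := abs_mul _ _
      _ ≤ abar * CH := by gcongr
  have hab : a' * b ≤ Cα * β := by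
    calc a' * b ≤ |a' * b| := le_abs_self _
      _ = |a'| * |b| := abs_mul _ _
      _ ≤ Cα * β := by rw [hβ]; gcongr
  have h1W : 0 < 1 - W ^ 2 := by linarith
  have hmain : β * (1 - W ^ 2) ≤ W * (A * β + (1 - W ^ 2) * B) := by
    have h1 : κlow * β ^ 2 * (1 - W ^ 2) ≤ W * (abar * CH * β ^ 2 + (1 - W ^ 2) * (Cα * β)) := by
      have e1 : a * w * (W * b ^ 2) ≤ abar * CH * (W * b ^ 2) := by gcongr
      have e2 : a' * b * (W * (1 - W ^ 2)) ≤ Cα * β * (W * (1 - W ^ 2)) := by gcongr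
      have e3 : κlow * (b ^ 2 * (1 - W ^ 2)) ≤ κ * (b ^ 2 * (1 - W ^ 2)) := by gcongr
      rw [hβ2]
      linarith
    have h2 : (κlow * β) * (β * (1 - W ^ 2)) ≤ (κlow * β) * (W * (A * β + (1 - W ^ 2) * B)) := by
      rw [← hkA, ← hkB] at h1
      linarith
    exact le_of_mul_le_mul_left h2 (by positivity)
  have hfin := one_le_of_frame_inequality (X := A * W) (Y := B * W) hWpos (by positivity)
    (by positivity) hm1 hmW hβpos hs (by linarith)
  linarith

end BoundaryAlgebra

section Linearization

variable {Ω : Set (Fin 2 → ℝ)} {γ : (Fin 2 → ℝ) → Fin 2 → ℝ} {α : (Fin 2 → ℝ) → ℝ} {T : ℝ}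
  {U f g : (Fin 2 → ℝ) × ℝ → ℝ} {q : (Fin 2 → ℝ) × ℝ}

lemma dirDeriv_linComb {S : Set ((Fin 2 → ℝ) × ℝ)} (hS : UniqueDiffOn ℝ S)
    (hf : ContDiffOn ℝ (⊤ : ℕ∞) f S) (hg : ContDiffOn ℝ (⊤ : ℕ∞) g S) (a b : ℝ)
    (d : (Fin 2 → ℝ) × ℝ) :
    EqOn (dirDeriv S d fun q => a * f q + b * g q)
      (fun q => a * dirDeriv S d f q + b * dirDeriv S d g q) S := fun _ hq =>
  (((hf.hasFDerivWithinAt' hq).const_mul a).add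
    ((hg.hasFDerivWithinAt' hq).const_mul b)).dirDeriv_eq hS hq d

lemma hess_linComb (hS : UniqueDiffOn ℝ (cylinder Ω T))
    (hf : ContDiffOn ℝ (⊤ : ℕ∞) f (cylinder Ω T)) (hg : ContDiffOn ℝ (⊤ : ℕ∞) g (cylinder Ω T))
    (a b : ℝ) (i j : Fin 2) (hq : q ∈ cylinder Ω T) :
    hess Ω T (fun q => a * f q + b * g q) i j q = a * hess Ω T f i j q + b * hess Ω T g i j q :=
  (dirDeriv_congr (dirDeriv_linComb hS hf hg a b (spaceDir j)) (spaceDir i) hq).trans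
    (dirDeriv_linComb hS (hf.grad hS j) (hg.grad hS j) a b (spaceDir i) hq)

lemma principalPart_linComb (hS : UniqueDiffOn ℝ (cylinder Ω T))
    (hf : ContDiffOn ℝ (⊤ : ℕ∞) f (cylinder Ω T)) (hg : ContDiffOn ℝ (⊤ : ℕ∞) g (cylinder Ω T))
    (a b : ℝ) (hq : q ∈ cylinder Ω T) :
    principalPart Ω T U (fun q => a * f q + b * g q) q
      = a * principalPart Ω T U f q + b * principalPart Ω T U g q := by
  simp only [principalPart, hess_linComb hS hf hg a b _ _ hq]
  ring

/-- The principal part is nonpositive where all second spatial derivatives are. -/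
lemma principalPart_nonpos (hΩo : IsOpen Ω) (hS : UniqueDiffOn ℝ (cylinder Ω T))
    (hf : ContDiffOn ℝ (⊤ : ℕ∞) f (cylinder Ω T)) (hq : q ∈ cylinder Ω T)
    (hZ : 0 ≤ lapseSq Ω T U q)
    (h : ∀ d, dirDeriv (cylinder Ω T) (d, 0) (dirDeriv (cylinder Ω T) (d, 0) f) q ≤ 0) :
    principalPart Ω T U f q ≤ 0 := by
  have h00 : hess Ω T f 0 0 q ≤ 0 := h _
  have h11 : hess Ω T f 1 1 q ≤ 0 := h _
  have hp := h ![grad Ω T U 0 q, grad Ω T U 1 q]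
  rw [dirDeriv_space_space hS (cylinder_subset_closure_interior hΩo) hf _ hq] at hp
  have := mul_nonpos_of_nonneg_of_nonpos hZ (add_nonpos h00 h11)
  exact add_nonpos this hp

/-- The linearization of the operator `principalPart U U - (1 - |DU|²) ∂ₜU`, up to its time
derivative part. -/
def linearPart (Ω : Set (Fin 2 → ℝ)) (T : ℝ) (U f : (Fin 2 → ℝ) × ℝ → ℝ)
    (q : (Fin 2 → ℝ) × ℝ) : ℝ :=
  2 * (grad Ω T U 0 q * grad Ω T f 0 q + grad Ω T U 1 q * grad Ω T f 1 q)
      * (timeDeriv Ω T U q - (hess Ω T U 0 0 q + hess Ω T U 1 1 q))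
    + principalPart Ω T U f q
    + 2 * (grad Ω T U 0 q * grad Ω T f 0 q * hess Ω T U 0 0 q
      + (grad Ω T U 0 q * grad Ω T f 1 q + grad Ω T U 1 q * grad Ω T f 0 q) * hess Ω T U 0 1 q
      + grad Ω T U 1 q * grad Ω T f 1 q * hess Ω T U 1 1 q)

lemma ContDiffOn.linearPart (hS : UniqueDiffOn ℝ (cylinder Ω T))
    (hU : ContDiffOn ℝ (⊤ : ℕ∞) U (cylinder Ω T))
    (hf : ContDiffOn ℝ (⊤ : ℕ∞) f (cylinder Ω T)) :
    ContDiffOn ℝ (⊤ : ℕ∞) (linearPart Ω T U f) (cylinder Ω T) := by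
  have p := hU.grad hS
  have r := hf.grad hS
  have k := hU.hess hS
  exact (((contDiffOn_const.mul (((p 0).mul (r 0)).add ((p 1).mul (r 1)))).mul
    ((hU.timeDeriv hS).sub ((k 0 0).add (k 1 1)))).add (hU.principalPart hS hf)).add
    (contDiffOn_const.mul (((((p 0).mul (r 0)).mul (k 0 0)).add
      ((((p 0).mul (r 1)).add ((p 1).mul (r 0))).mul (k 0 1))).add
      (((p 1).mul (r 1)).mul (k 1 1))))

/-- The time derivative of a solution solves the linearized equation. -/
lemma IsFlow.timeDeriv_timeDeriv (hΩo : IsOpen Ω) (hS : UniqueDiffOn ℝ (cylinder Ω T))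
    (hU : IsFlow Ω γ α T U) (hq : q ∈ cylinder Ω T) :
    lapseSq Ω T U q * timeDeriv Ω T (timeDeriv Ω T U) q
      = linearPart Ω T U (timeDeriv Ω T U) q := by
  have hcl := cylinder_subset_closure_interior (T := T) hΩo
  have h1 : ∀ i, EqOn (dirDeriv (cylinder Ω T) timeDir (grad Ω T U i))
      (grad Ω T (timeDeriv Ω T U) i) (cylinder Ω T) :=
    fun i => dirDeriv_comm hU.smooth hS hcl _ _
  have h2 : ∀ i j, dirDeriv (cylinder Ω T) timeDir (hess Ω T U i j) q
      = hess Ω T (timeDeriv Ω T U) i j q := fun i j =>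
    (dirDeriv_comm (hU.smooth.grad hS j) hS hcl _ _ hq).trans (dirDeriv_congr (h1 j) _ hq)
  have h3 := hU.dirDeriv_pde hS hq (d := timeDir) rfl
  simp only [h1 _ hq, h2] at h3
  rw [linearPart, principalPart]
  exact h3

/-- At an interior point where `σ ∂ₜU - ε G` satisfies the necessary conditions for a maximum,
`G` is a subsolution of the linearized equation. -/
lemma IsFlow.timeDeriv_mul_le_linearPart (hΩo : IsOpen Ω) (hS : UniqueDiffOn ℝ (cylinder Ω T))
    (hU : IsFlow Ω γ α T U) (hg : ContDiffOn ℝ (⊤ : ℕ∞) g (cylinder Ω T))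
    (hq : q ∈ cylinder Ω T) {σ ε : ℝ} (hε : 0 < ε)
    (hf : f = fun q => σ * timeDeriv Ω T U q + (-ε) * g q)
    (ht : 0 ≤ timeDeriv Ω T f q)
    (h : ∀ d, dirDeriv (cylinder Ω T) (d, 0) f q = 0 ∧
      dirDeriv (cylinder Ω T) (d, 0) (dirDeriv (cylinder Ω T) (d, 0) f) q ≤ 0) :
    timeDeriv Ω T g q * lapseSq Ω T U q ≤ linearPart Ω T U g q := by
  have hw := hU.smooth.timeDeriv hS
  have hfs : ContDiffOn ℝ (⊤ : ℕ∞) f (cylinder Ω T) := by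
    rw [hf]
    exact (contDiffOn_const.mul hw).add (contDiffOn_const.mul hg)
  have hZ := hU.lapseSq_pos q hq
  have hPP := principalPart_nonpos hΩo hS hfs hq hZ.le fun d => (h d).2
  have hd : ∀ d, dirDeriv (cylinder Ω T) d f q = σ * dirDeriv (cylinder Ω T) d (timeDeriv Ω T U) q
      + (-ε) * dirDeriv (cylinder Ω T) d g q := fun d => by
    rw [hf]; exact dirDeriv_linComb hS hw hg _ _ d hq
  have h0 : σ * grad Ω T (timeDeriv Ω T U) 0 q + (-ε) * grad Ω T g 0 q = 0 :=
    (hd _).symm.trans (h (Pi.single 0 1)).1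
  have h1 : σ * grad Ω T (timeDeriv Ω T U) 1 q + (-ε) * grad Ω T g 1 q = 0 :=
    (hd _).symm.trans (h (Pi.single 1 1)).1
  have ht' : 0 ≤ σ * timeDeriv Ω T (timeDeriv Ω T U) q + (-ε) * timeDeriv Ω T g q :=
    ht.trans_eq (hd _)
  rw [hf, principalPart_linComb hS hw hg _ _ hq] at hPP
  have hpde := hU.timeDeriv_timeDeriv hΩo hS hq
  have hZt := mul_nonneg hZ.le ht'
  have hlin : σ * linearPart Ω T U (timeDeriv Ω T U) q - ε * linearPart Ω T U g q
      = σ * principalPart Ω T U (timeDeriv Ω T U) q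
        + (-ε) * principalPart Ω T U g q := by
    simp only [linearPart]
    generalize grad Ω T (timeDeriv Ω T U) 0 q = w0 at *
    generalize grad Ω T (timeDeriv Ω T U) 1 q = w1 at *
    linear_combination (2 * grad Ω T U 0 q * (timeDeriv Ω T U q - (hess Ω T U 0 0 q
      + hess Ω T U 1 1 q)) + 2 * (grad Ω T U 0 q * hess Ω T U 0 0 q
      + grad Ω T U 1 q * hess Ω T U 0 1 q)) * h0
      + (2 * grad Ω T U 1 q * (timeDeriv Ω T U q - (hess Ω T U 0 0 q + hess Ω T U 1 1 q))
      + 2 * (grad Ω T U 0 q * hess Ω T U 0 1 q + grad Ω T U 1 q * hess Ω T U 1 1 q)) * h1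
  have hfin : ε * (timeDeriv Ω T g q * lapseSq Ω T U q) ≤ ε * linearPart Ω T U g q := by
    have : lapseSq Ω T U q * (σ * timeDeriv Ω T (timeDeriv Ω T U) q + (-ε) * timeDeriv Ω T g q)
        = σ * linearPart Ω T U (timeDeriv Ω T U) q
          - ε * (timeDeriv Ω T g q * lapseSq Ω T U q) := by
      rw [← hpde]; ring
    linarith
  exact le_of_mul_le_mul_left hfin hε

/-- The time derivative of a solution satisfies a homogeneous oblique boundary condition; in
particular its normal derivative vanishes where its tangential derivative does. -/
lemma IsFlow.grad_timeDeriv_eq_zero (hΩo : IsOpen Ω) (hS : UniqueDiffOn ℝ (cylinder Ω T))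
    (hU : IsFlow Ω γ α T U) {x τ : Fin 2 → ℝ} {t : ℝ} (hx : x ∈ frontier Ω) (ht : t ∈ Ico 0 T)
    (hg : ∑ i, (γ x i) ^ 2 = 1) (hτ : ∑ i, (τ i) ^ 2 = 1) (hgτ : ∑ i, γ x i * τ i = 0)
    (hτw : dirDeriv (cylinder Ω T) (τ, 0) (timeDeriv Ω T U) (x, t) = 0) (d : Fin 2 → ℝ) :
    dirDeriv (cylinder Ω T) (d, 0) (timeDeriv Ω T U) (x, t) = 0 := by
  have hcl := cylinder_subset_closure_interior (T := T) hΩo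
  have hx' := frontier_subset_closure hx
  have hq : (x, t) ∈ cylinder Ω T := ⟨hx', ht⟩
  have hZ := hU.lapseSq_pos _ hq
  have hW := Real.sqrt_pos.2 hZ
  have h1 : ∀ i, dirDeriv (cylinder Ω T) timeDir (grad Ω T U i) (x, t)
      = grad Ω T (timeDeriv Ω T U) i (x, t) :=
    fun i => dirDeriv_comm hU.smooth hS hcl _ _ hq
  have hs0 := hasDerivWithinAt_time_slice (hU.smooth.grad hS 0) hx' ht
  have hs1 := hasDerivWithinAt_time_slice (hU.smooth.grad hS 1) hx' ht
  have hsZ := hasDerivWithinAt_time_slice (hU.smooth.lapseSq hS) hx' ht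
  rw [h1] at hs0 hs1
  rw [dirDeriv_lapseSq hS hU.smooth hq, h1, h1] at hsZ
  have hl := (hs0.const_mul (γ x 0)).add (hs1.const_mul (γ x 1))
  have hr := ((hsZ.sqrt hZ.ne').const_mul (α x)).congr
    (fun s hs => hU.neumann x hx s hs) (hU.neumann x hx t ht)
  have hkey := (uniqueDiffOn_Ico 0 T t ht).eq_deriv _ hl hr
  have hn := hU.neumann x hx t ht
  rw [dirDeriv_space] at hτw ⊢
  change d 0 * grad Ω T (timeDeriv Ω T U) 0 (x, t) + d 1 * grad Ω T (timeDeriv Ω T U) 1 (x, t) = 0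
  change τ 0 * grad Ω T (timeDeriv Ω T U) 0 (x, t)
    + τ 1 * grad Ω T (timeDeriv Ω T U) 1 (x, t) = 0 at hτw
  have hdec := frame_decomp hg hτ hgτ
    ![grad Ω T (timeDeriv Ω T U) 0 (x, t), grad Ω T (timeDeriv Ω T U) 1 (x, t)]
  have hd0 := congrFun hdec 0
  have hd1 := congrFun hdec 1
  simp [Fin.sum_univ_two, hτw] at hd0 hd1
  generalize grad Ω T (timeDeriv Ω T U) 0 (x, t) = w0 at *
  generalize grad Ω T (timeDeriv Ω T U) 1 (x, t) = w1 at *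
  generalize grad Ω T U 0 (x, t) = p0 at *
  generalize grad Ω T U 1 (x, t) = p1 at *
  obtain ⟨N, hN⟩ : ∃ N, N = γ x 0 * w0 + γ x 1 * w1 := ⟨_, rfl⟩
  generalize √(lapseSq Ω T U (x, t)) = W at *
  rw [← hN] at hd0 hd1 hkey
  have hp : p0 * w0 + p1 * w1 = N * (α x * W) := by
    rw [hd0, hd1, ← hn]; ring
  have hN0 : N * (1 + α x ^ 2) = 0 := by
    rw [hp] at hkey
    field_simp at hkey
    linarith
  have hN0' : N = 0 := by
    rcases mul_eq_zero.1 hN0 with h | h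
    · exact h
    · nlinarith [sq_nonneg (α x)]
  rw [hd0, hd1, hN0']
  ring

end Linearization

section TimeDerivativeBound

variable {Ω : Set (Fin 2 → ℝ)} {γ : (Fin 2 → ℝ) → Fin 2 → ℝ} {α : (Fin 2 → ℝ) → ℝ} {T : ℝ}
  {U f g : (Fin 2 → ℝ) × ℝ → ℝ} {c : ℝ → Fin 2 → ℝ}

/-- A bound on the initial slice over the open domain extends to its closure. -/
lemma le_on_initial_closure (hT : 0 < T) (hf : ContDiffOn ℝ (⊤ : ℕ∞) f (cylinder Ω T)) {M : ℝ}
    (h : ∀ x ∈ Ω, f (x, 0) ≤ M) : ∀ x ∈ closure Ω, f (x, 0) ≤ M := by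
  intro x hx
  have hcont : ContinuousOn (fun y => f (y, (0 : ℝ))) (closure Ω) :=
    hf.continuousOn.comp (by fun_prop) fun y hy => ⟨hy, le_rfl, hT⟩
  exact le_on_closure h hcont continuousOn_const hx

/-- Spatial functions as functions on space-time, plus a linear function of time. -/
lemma dirDeriv_space_add_time {S : Set ((Fin 2 → ℝ) × ℝ)} (hS : UniqueDiffOn ℝ S)
    {h : (Fin 2 → ℝ) → ℝ} (hh : ContDiff ℝ (⊤ : ℕ∞) h) (K : ℝ) (d : (Fin 2 → ℝ) × ℝ) :
    EqOn (dirDeriv S d fun q => h q.1 + K * q.2) (fun q => fderiv ℝ h q.1 d.1 + K * d.2) S := by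
  intro q hq
  have h1 : HasFDerivWithinAt h (fderiv ℝ h q.1) univ q.1 :=
    (hh.differentiable (by simp) q.1).hasFDerivAt.hasFDerivWithinAt
  have h2 : HasFDerivWithinAt (fun q : (Fin 2 → ℝ) × ℝ => h q.1)
      ((fderiv ℝ h q.1).comp (ContinuousLinearMap.fst ℝ (Fin 2 → ℝ) ℝ)) S q :=
    HasFDerivWithinAt.comp q h1 hasFDerivWithinAt_fst (mapsTo_univ _ _)
  have h3 : HasFDerivWithinAt (fun q : (Fin 2 → ℝ) × ℝ => q.2)
      (ContinuousLinearMap.snd ℝ (Fin 2 → ℝ) ℝ) S q := hasFDerivWithinAt_snd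
  exact (h2.add (h3.const_mul K)).dirDeriv_eq hS hq d

lemma linearPart_space_add_time (hS : UniqueDiffOn ℝ (cylinder Ω T))
    {h : (Fin 2 → ℝ) → ℝ} (hh : ContDiff ℝ (⊤ : ℕ∞) h) (K : ℝ) :
    EqOn (linearPart Ω T U fun q => h q.1 + K * q.2) (linearPart Ω T U fun q => h q.1 + 0 * q.2)
      (cylinder Ω T) := by
  intro q hq
  have h1 : ∀ i, EqOn (grad Ω T (fun q => h q.1 + K * q.2) i)
      (grad Ω T (fun q => h q.1 + 0 * q.2) i) (cylinder Ω T) := fun i p hp =>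
    (dirDeriv_space_add_time hS hh K _ hp).trans
      ((by simp : _ = _).trans (dirDeriv_space_add_time hS hh 0 _ hp).symm)
  have h2 : ∀ i j, hess Ω T (fun q => h q.1 + K * q.2) i j q
      = hess Ω T (fun q => h q.1 + 0 * q.2) i j q := fun i j => dirDeriv_congr (h1 j) _ hq
  simp only [linearPart, principalPart, h1 _ hq, h2]

/-- The time derivative of a solution is bounded by its initial values, with a small error. -/
lemma IsFlow.timeDeriv_le (hΩo : IsOpen Ω) (hΩconv : Convex ℝ Ω)
    (hΩbd : Bornology.IsBounded Ω) (hΩne : Ω.Nonempty)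
    (hγunit : ∀ x ∈ frontier Ω, ∑ i, (γ x i) ^ 2 = 1)
    (hγout : ∀ x ∈ frontier Ω, ∀ y ∈ Ω, ∑ i, γ x i * (y i - x i) ≤ 0)
    (hc : ContDiff ℝ (⊤ : ℕ∞) c) (hcrange : range c = frontier Ω)
    (hcunit : ∀ s, ∑ i, (deriv c s i) ^ 2 = 1)
    (hperp : ∀ s, ∑ i, γ (c s) i * deriv c s i = 0)
    (hU : IsFlow Ω γ α T U) {σ M : ℝ} (hM : ∀ x ∈ closure Ω, σ * timeDeriv Ω T U (x, 0) ≤ M)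
    {x : Fin 2 → ℝ} {t : ℝ} (hx : x ∈ closure Ω) (ht : t ∈ Ico 0 T) :
    σ * timeDeriv Ω T U (x, t) ≤ M := by
  have hS := uniqueDiffOn_cylinder (T := T) hΩo hΩconv hΩne
  have hw := hU.smooth.timeDeriv hS
  obtain ⟨x₀, hx₀⟩ := hΩne
  obtain ⟨h, hh, hh1, hhd⟩ :=
    exists_boundary_barrier hΩo hΩconv hΩbd hγunit hγout hc hcrange hcunit hperp hx₀
  have hGs : ∀ K : ℝ, ContDiffOn ℝ (⊤ : ℕ∞) (fun q : (Fin 2 → ℝ) × ℝ => h q.1 + K * q.2)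
      (cylinder Ω T) := fun K =>
    ((hh.comp contDiff_fst).add (contDiff_const.mul contDiff_snd)).contDiffOn
  set A : Set ((Fin 2 → ℝ) × ℝ) := closure Ω ×ˢ Icc 0 t with hA
  have hAS : A ⊆ cylinder Ω T :=
    prod_mono subset_rfl (fun s hs => ⟨hs.1, hs.2.trans_lt ht.2⟩)
  have hAc : IsCompact A := hΩbd.isCompact_closure.prod isCompact_Icc
  obtain ⟨N, hN⟩ := hΩbd.isCompact_closure.exists_bound_of_continuousOn hh.continuous.continuousOn
  obtain ⟨B, hB⟩ := hAc.exists_bound_of_continuousOn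
    ((((hU.smooth.linearPart hS (hGs 0)).div (hU.smooth.lapseSq hS)
      fun q hq => (hU.lapseSq_pos q hq).ne').continuousOn).mono hAS)
  have key : ∀ ε > 0, σ * timeDeriv Ω T U (x, t) ≤ M + ε * (2 * N + (B + 1) * t) := by
    intro ε hε
    set G : (Fin 2 → ℝ) × ℝ → ℝ := fun q => h q.1 + (B + 1) * q.2 with hG
    set f : (Fin 2 → ℝ) × ℝ → ℝ := fun q => σ * timeDeriv Ω T U q + (-ε) * G q with hf
    have hfs : ContDiffOn ℝ (⊤ : ℕ∞) f (cylinder Ω T) :=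
      (contDiffOn_const.mul hw).add (contDiffOn_const.mul (hGs _))
    obtain ⟨z, hz, r, hr, hmax, hrt, hint, htan, hout⟩ :=
      exists_max_cylinder hΩo hΩconv hΩbd ⟨x₀, hx₀⟩ (hc.differentiable (by simp)) hcrange hfs ht
    have hzr : (z, r) ∈ A := ⟨hz, hr⟩
    have hq := hAS hzr
    have hfd : ∀ d, dirDeriv (cylinder Ω T) d f (z, r)
        = σ * dirDeriv (cylinder Ω T) d (timeDeriv Ω T U) (z, r)
          + (-ε) * (fderiv ℝ h z d.1 + (B + 1) * d.2) := fun d => by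
      have h1 := dirDeriv_linComb hS hw (hGs (B + 1)) σ (-ε) d hq
      have h2 := dirDeriv_space_add_time hS hh (B + 1) d hq
      simp only at h1 h2
      rw [← h2]
      exact h1
    have hzΩ : z ∈ frontier Ω → False := by
      intro hzf
      obtain ⟨s, rfl⟩ := hcrange ▸ hzf
      have h1 := htan s rfl
      have h2 : fderiv ℝ h (c s) (deriv c s) = 0 := by
        have h3 := ((hh.differentiable (by simp) (c s)).hasFDerivAt).comp_hasDerivAt s
          ((hc.differentiable (by simp) s).hasDerivAt)
        have h4 : h ∘ c = fun _ => 1 := funext fun r => hh1 _ (hcrange ▸ mem_range_self r)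
        rw [h4] at h3
        exact h3.unique (hasDerivAt_const s 1)
      rw [hfd] at h1
      have h5 : σ * dirDeriv (cylinder Ω T) (deriv c s, 0) (timeDeriv Ω T U) (c s, r) = 0 := by
        simpa [h2] using h1
      have h6 := hout x₀ hx₀
      rw [hfd, hhd _ hzf] at h6
      rcases mul_eq_zero.1 h5 with h7 | h7
      · rw [h7] at h6
        simp at h6
        linarith
      · rw [hU.grad_timeDeriv_eq_zero hΩo hS hzf hq.2 (hγunit _ hzf) (hcunit s) (hperp s) h7] at h6
        simp at h6
        linarith
    have hzint : z ∈ Ω := by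
      by_contra hcon
      exact hzΩ ⟨hz, fun h => hcon (interior_subset h)⟩
    have hr0 : r = 0 := by
      by_contra hne
      have hpos : 0 < r := lt_of_le_of_ne hr.1 (Ne.symm hne)
      have h1 := hU.timeDeriv_mul_le_linearPart hΩo hS (hGs (B + 1)) hq hε hf (hrt hpos)
        (hint hzint)
      have h2 : timeDeriv Ω T G (z, r) = B + 1 :=
        (dirDeriv_space_add_time hS hh (B + 1) timeDir hq).trans (by simp)
      have h3 := linearPart_space_add_time (U := U) hS hh (B + 1) hq
      rw [h2, h3] at h1
      have h4 := (le_abs_self _).trans (hB _ hzr)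
      have hZ := hU.lapseSq_pos _ hq
      simp only [Pi.div_apply] at h4
      rw [div_le_iff₀ hZ] at h4
      linarith
    subst hr0
    have h1 := hmax x hx t ⟨ht.1, le_rfl⟩
    have h2 := hM z hz
    have h3 := abs_le.1 (hN x hx)
    have h4 := abs_le.1 (hN z hz)
    simp only [hf, hG] at h1
    have h5 : ε * (h x - h z) ≤ ε * (2 * N) := by gcongr; linarith
    linarith
  have hlim : Tendsto (fun ε : ℝ => M + ε * (2 * N + (B + 1) * t)) (𝓝[>] 0) (𝓝 M) := by
    have : Continuous fun ε : ℝ => M + ε * (2 * N + (B + 1) * t) := by fun_prop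
    have h := this.tendsto 0
    simp only [zero_mul, add_zero] at h
    exact h.mono_left nhdsWithin_le_nhds
  exact ge_of_tendsto hlim (eventually_mem_nhdsWithin.mono fun ε hε => key ε hε)

end TimeDerivativeBound

section GradientBound

variable {Ω : Set (Fin 2 → ℝ)} {γ : (Fin 2 → ℝ) → Fin 2 → ℝ} {α : (Fin 2 → ℝ) → ℝ} {T : ℝ}
  {U : (Fin 2 → ℝ) × ℝ → ℝ} {c : ℝ → Fin 2 → ℝ} {q : (Fin 2 → ℝ) × ℝ}

lemma grad_lapseSq (hS : UniqueDiffOn ℝ (cylinder Ω T))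
    (hU : ContDiffOn ℝ (⊤ : ℕ∞) U (cylinder Ω T)) (i : Fin 2) (hq : q ∈ cylinder Ω T) :
    grad Ω T (lapseSq Ω T U) i q
      = -(2 * (grad Ω T U 0 q * hess Ω T U i 0 q + grad Ω T U 1 q * hess Ω T U i 1 q)) :=
  dirDeriv_lapseSq hS hU hq _

lemma hess_lapseSq (hΩo : IsOpen Ω) (hS : UniqueDiffOn ℝ (cylinder Ω T))
    (hU : ContDiffOn ℝ (⊤ : ℕ∞) U (cylinder Ω T)) (i j : Fin 2) (hq : q ∈ cylinder Ω T) :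
    hess Ω T (lapseSq Ω T U) i j q
      = -(2 * (hess Ω T U i 0 q * hess Ω T U j 0 q + hess Ω T U i 1 q * hess Ω T U j 1 q
        + (grad Ω T U 0 q * grad Ω T (hess Ω T U i j) 0 q
          + grad Ω T U 1 q * grad Ω T (hess Ω T U i j) 1 q))) := by
  have hcl := cylinder_subset_closure_interior (T := T) hΩo
  have hthird : ∀ k, grad Ω T (hess Ω T U j k) i q = grad Ω T (hess Ω T U i j) k q := fun k => by
    have h1 : EqOn (hess Ω T U j k) (hess Ω T U k j) (cylinder Ω T) :=
      dirDeriv_comm hU hS hcl _ _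
    exact (dirDeriv_congr h1 _ hq).trans (dirDeriv_comm (hU.grad hS j) hS hcl _ _ hq)
  have h1 := dirDeriv_congr (fun q hq => grad_lapseSq hS hU j hq) (spaceDir i) hq
  have h0' := (hU.grad hS 0).hasFDerivWithinAt' hq
  have h1' := (hU.grad hS 1).hasFDerivWithinAt' hq
  have k0 := (hU.hess hS j 0).hasFDerivWithinAt' hq
  have k1 := (hU.hess hS j 1).hasFDerivWithinAt' hq
  have h2 := (((h0'.mul k0).add (h1'.mul k1)).const_mul 2).neg.dirDeriv_eq hS hq (spaceDir i)
  have h3 : hess Ω T (lapseSq Ω T U) i j q = _ := h1.trans h2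
  rw [h3, ← hthird 0, ← hthird 1]
  have e1 : ∀ k, fderivWithin ℝ (grad Ω T U k) (cylinder Ω T) q (spaceDir i)
      = hess Ω T U i k q := fun _ => rfl
  have e2 : ∀ k, fderivWithin ℝ (hess Ω T U j k) (cylinder Ω T) q (spaceDir i)
      = grad Ω T (hess Ω T U j k) i q := fun _ => rfl
  simp only [neg_apply, smul_apply, add_apply, smul_eq_mul, e1, e2]
  ring

/-- The evolution of `1 - |DU|²` at its critical points. -/
lemma IsFlow.lapseSq_evolution (hΩo : IsOpen Ω) (hS : UniqueDiffOn ℝ (cylinder Ω T))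
    (hU : IsFlow Ω γ α T U) (hq : q ∈ cylinder Ω T)
    (hcrit : ∀ i, grad Ω T (lapseSq Ω T U) i q = 0) :
    lapseSq Ω T U q * timeDeriv Ω T (lapseSq Ω T U) q
      = principalPart Ω T U (lapseSq Ω T U) q
        + 2 * lapseSq Ω T U q
          * (hess Ω T U 0 0 q ^ 2 + 2 * hess Ω T U 0 1 q ^ 2 + hess Ω T U 1 1 q ^ 2) := by
  have hcl := cylinder_subset_closure_interior (T := T) hΩo
  have hsym := hess_symm hΩo hS hU.smooth hq
  have hc0 := hcrit 0
  have hc1 := hcrit 1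
  rw [grad_lapseSq hS hU.smooth _ hq] at hc0 hc1
  have ht : ∀ k, dirDeriv (cylinder Ω T) (spaceDir k) (timeDeriv Ω T U) q
      = timeDeriv Ω T (grad Ω T U k) q := fun k => dirDeriv_comm hU.smooth hS hcl _ _ hq
  have hp0 := hU.dirDeriv_pde hS hq (d := spaceDir 0) rfl
  have hp1 := hU.dirDeriv_pde hS hq (d := spaceDir 1) rfl
  have hg : ∀ k i j, dirDeriv (cylinder Ω T) (spaceDir k) (hess Ω T U i j) q
      = grad Ω T (hess Ω T U i j) k q := fun _ _ _ => rfl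
  have hh : ∀ k i, dirDeriv (cylinder Ω T) (spaceDir k) (grad Ω T U i) q
      = hess Ω T U k i q := fun _ _ => rfl
  simp only [ht, hg, hh, hsym] at hp0 hp1
  have htZ : timeDeriv Ω T (lapseSq Ω T U) q
      = -(2 * (grad Ω T U 0 q * timeDeriv Ω T (grad Ω T U 0) q
        + grad Ω T U 1 q * timeDeriv Ω T (grad Ω T U 1) q)) :=
    dirDeriv_lapseSq hS hU.smooth hq _
  rw [htZ, principalPart, hess_lapseSq hΩo hS hU.smooth 0 0 hq,
    hess_lapseSq hΩo hS hU.smooth 0 1 hq, hess_lapseSq hΩo hS hU.smooth 1 1 hq]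
  rw [hsym] at hc1 ⊢
  have hq0 : grad Ω T U 0 q * hess Ω T U 0 0 q + grad Ω T U 1 q * hess Ω T U 0 1 q = 0 := by
    linarith
  have hq1 : grad Ω T U 0 q * hess Ω T U 0 1 q + grad Ω T U 1 q * hess Ω T U 1 1 q = 0 := by
    linarith
  generalize grad Ω T U 0 q = p0 at *
  generalize grad Ω T U 1 q = p1 at *
  generalize hess Ω T U 0 0 q = h00 at *
  generalize hess Ω T U 0 1 q = h01 at *
  generalize hess Ω T U 1 1 q = h11 at *
  generalize timeDeriv Ω T U q = w at *
  rw [hq0] at hp0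
  rw [hq1] at hp1
  linear_combination (-2 * p0) * hp0 + (-2 * p1) * hp1
    + 2 * (-(p0 * h00 + p1 * h01)) * hq0 + 2 * (-(p0 * h01 + p1 * h11)) * hq1

/-- The gradient bound at boundary points satisfying the necessary conditions for a minimum of
`1 - |DU|²`. -/
lemma IsFlow.one_le_mul_sqrt_lapseSq (hΩo : IsOpen Ω) (hΩconv : Convex ℝ Ω)
    (hγunit : ∀ x ∈ frontier Ω, ∑ i, (γ x i) ^ 2 = 1)
    (hγout : ∀ x ∈ frontier Ω, ∀ y ∈ Ω, ∑ i, γ x i * (y i - x i) ≤ 0)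
    {κ : ℝ → ℝ} (hc : ContDiff ℝ (⊤ : ℕ∞) c) (hcrange : range c = frontier Ω)
    (hcunit : ∀ s, ∑ i, (deriv c s i) ^ 2 = 1)
    (hccurv : ∀ s, deriv (deriv c) s = (-(κ s)) • γ (c s)) (hκpos : ∀ s, 0 < κ s)
    (hαs : ContDiffOn ℝ (⊤ : ℕ∞) α (frontier Ω)) (hU : IsFlow Ω γ α T U)
    {αbar Cα κlow CH C : ℝ} (hαbar : ∀ x ∈ frontier Ω, |α x| ≤ αbar)
    (hCα : ∀ s : ℝ, |deriv (fun r => α (c r)) s| ≤ Cα)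
    (hκlow : 0 < κlow) (hκlow' : ∀ s, κlow ≤ κ s)
    (hC1 : 2 * √(1 + αbar ^ 2) ≤ C)
    (hC2 : (1 + αbar ^ 2) * (κlow⁻¹ * αbar * CH + κlow⁻¹ * (2 * αbar ^ 2 + 1) * Cα + 1) ≤ C)
    {s t : ℝ} (ht : t ∈ Ico 0 T) (hw : |timeDeriv Ω T U (c s, t)| ≤ CH)
    (htan : dirDeriv (cylinder Ω T) (deriv c s, 0) (lapseSq Ω T U) (c s, t) = 0)
    {x₀ : Fin 2 → ℝ} (hx₀ : x₀ ∈ Ω)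
    (hout : dirDeriv (cylinder Ω T) (c s - x₀, 0) (lapseSq Ω T U) (c s, t) ≤ 0) :
    1 ≤ C * √(lapseSq Ω T U (c s, t)) := by
  have hS := uniqueDiffOn_cylinder (T := T) hΩo hΩconv ⟨x₀, hx₀⟩
  have hcf : ∀ r, c r ∈ frontier Ω := fun r => hcrange ▸ mem_range_self r
  have hmem : ∀ᶠ r in 𝓝 s, c r ∈ closure Ω :=
    Eventually.of_forall fun r => frontier_subset_closure (hcf r)
  have hq : (c s, t) ∈ cylinder Ω T := ⟨frontier_subset_closure (hcf s), ht⟩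
  have hZ := hU.lapseSq_pos _ hq
  have hW := Real.sqrt_pos.2 hZ
  have hperp := inner_normal_tangent hcunit hc hccurv hκpos s
  have hsym := hess_symm hΩo hS hU.smooth hq
  have hgτ : 0 ≤ -dirDeriv (cylinder Ω T) (γ (c s), 0) (lapseSq Ω T U) (c s, t) := by
    have hpos := normal_pos hΩo hγunit hγout (hcf s) hx₀
    have hdec := frame_decomp (hγunit _ (hcf s)) (hcunit s) hperp (c s - x₀)
    have hdir : ((c s - x₀, 0) : (Fin 2 → ℝ) × ℝ)
        = (∑ i, γ (c s) i * (c s i - x₀ i)) • ((γ (c s), 0) : (Fin 2 → ℝ) × ℝ)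
          + (∑ i, deriv c s i * (c s i - x₀ i)) • ((deriv c s, 0) : (Fin 2 → ℝ) × ℝ) := by
      refine Prod.ext hdec (by simp)
    rw [hdir, dirDeriv_add_dir, dirDeriv_smul_dir, dirDeriv_smul_dir, htan] at hout
    by_contra! hneg
    have := mul_pos hpos (neg_lt_zero.1 hneg)
    linarith
  have hdc := (hc.differentiable (by simp) s).hasDerivAt
  have hn := hasDerivAt_pi.1
    (hasDerivAt_normal hcunit hc (fun r => hγunit _ (hcf r)) hccurv hκpos s)
  have hα : HasDerivAt (fun r => α (c r)) (deriv (fun r => α (c r)) s) s := by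
    have h1 : ContDiffOn ℝ (⊤ : ℕ∞) (fun r => α (c r)) univ :=
      hαs.comp hc.contDiffOn fun r _ => hcf r
    exact ((contDiffOn_univ.1 h1).differentiable (by simp) s).hasDerivAt
  have hl := ((hn 0).mul (hasDerivAt_curve (hU.smooth.grad hS 0) hdc hmem ht)).add
    ((hn 1).mul (hasDerivAt_curve (hU.smooth.grad hS 1) hdc hmem ht))
  have hr := hα.mul ((hasDerivAt_curve (hU.smooth.lapseSq hS) hdc hmem ht).sqrt hZ.ne')
  have hkey := hl.unique (hr.congr_of_eventuallyEq
    (Eventually.of_forall fun r => hU.neumann (c r) (hcf r) t ht))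
  have hpde := hU.pde _ hq
  have hdl : ∀ d, dirDeriv (cylinder Ω T) (d, 0) (lapseSq Ω T U) (c s, t)
      = d 0 * grad Ω T (lapseSq Ω T U) 0 (c s, t) + d 1 * grad Ω T (lapseSq Ω T U) 1 (c s, t) :=
    fun d => dirDeriv_space d _ _
  have hdg : ∀ d i, dirDeriv (cylinder Ω T) (d, 0) (grad Ω T U i) (c s, t)
      = d 0 * hess Ω T U 0 i (c s, t) + d 1 * hess Ω T U 1 i (c s, t) :=
    fun d i => dirDeriv_space d _ _
  rw [htan, hdg, hdg, hsym] at hkey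
  rw [hdl, grad_lapseSq hS hU.smooth _ hq, grad_lapseSq hS hU.smooth _ hq, hsym] at htan hgτ
  simp only [Pi.smul_apply, smul_eq_mul, zero_div, mul_zero, add_zero] at hkey
  obtain ⟨hb, hineq⟩ := boundary_frame_inequality (hγunit _ (hcf s)) (hcunit s) hperp
    (p₀ := grad Ω T U 0 (c s, t)) (p₁ := grad Ω T U 1 (c s, t))
    (h₀₀ := hess Ω T U 0 0 (c s, t)) (h₀₁ := hess Ω T U 0 1 (c s, t))
    (h₁₁ := hess Ω T U 1 1 (c s, t)) (w := timeDeriv Ω T U (c s, t)) (a := α (c s))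
    (a' := deriv (fun r => α (c r)) s) (κ := κ s) hW (Real.sq_sqrt hZ.le) rfl
    (hU.neumann _ (hcf s) t ht) (by linarith) (by linarith) (by linarith)
    (by rw [Real.sq_sqrt hZ.le]; exact hpde)
  exact one_le_mul_of_frame_inequality hW (hαbar _ (hcf s)) (hCα s) hw hκlow (hκlow' s) hb hineq
    hC1 hC2

/-- A lower bound for `1 - |DU|²` at time zero and at the boundary points where it may be minimal
holds everywhere. -/
lemma IsFlow.le_lapseSq (hΩo : IsOpen Ω) (hΩconv : Convex ℝ Ω)
    (hΩbd : Bornology.IsBounded Ω) {x₀ : Fin 2 → ℝ} (hx₀ : x₀ ∈ Ω)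
    (hc : ContDiff ℝ (⊤ : ℕ∞) c) (hcrange : range c = frontier Ω)
    (hU : IsFlow Ω γ α T U) {m : ℝ} (hinit : ∀ x ∈ closure Ω, m ≤ lapseSq Ω T U (x, 0))
    (hbdry : ∀ s, ∀ t ∈ Ico 0 T,
      dirDeriv (cylinder Ω T) (deriv c s, 0) (lapseSq Ω T U) (c s, t) = 0 →
      dirDeriv (cylinder Ω T) (c s - x₀, 0) (lapseSq Ω T U) (c s, t) ≤ 0 →
      m ≤ lapseSq Ω T U (c s, t))
    {x : Fin 2 → ℝ} {t : ℝ} (hx : x ∈ closure Ω) (ht : t ∈ Ico 0 T) :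
    m ≤ lapseSq Ω T U (x, t) := by
  have hS := uniqueDiffOn_cylinder (T := T) hΩo hΩconv ⟨x₀, hx₀⟩
  have hZs := hU.smooth.lapseSq hS
  set G : (Fin 2 → ℝ) × ℝ → ℝ := fun q => (fun _ => 0 : (Fin 2 → ℝ) → ℝ) q.1 + 1 * q.2 with hG
  have hGs : ContDiffOn ℝ (⊤ : ℕ∞) G (cylinder Ω T) :=
    (contDiff_const.add (contDiff_const.mul contDiff_snd)).contDiffOn
  have key : ∀ ε > 0, m - ε * t ≤ lapseSq Ω T U (x, t) := by
    intro ε hε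
    set f : (Fin 2 → ℝ) × ℝ → ℝ := fun q => (-1) * lapseSq Ω T U q + (-ε) * G q with hf
    have hfs : ContDiffOn ℝ (⊤ : ℕ∞) f (cylinder Ω T) :=
      (contDiffOn_const.mul hZs).add (contDiffOn_const.mul hGs)
    obtain ⟨z, hz, r, hr, hmax, hrt, hint, htan, hout⟩ :=
      exists_max_cylinder hΩo hΩconv hΩbd ⟨x₀, hx₀⟩ (hc.differentiable (by simp)) hcrange hfs ht
    have hq : (z, r) ∈ cylinder Ω T := ⟨hz, hr.1, hr.2.trans_lt ht.2⟩
    have hGd : ∀ d, EqOn (dirDeriv (cylinder Ω T) d G) (fun _ => d.2) (cylinder Ω T) :=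
      fun d p hp => (dirDeriv_space_add_time hS contDiff_const 1 d hp).trans (by simp)
    have hfd : ∀ d, dirDeriv (cylinder Ω T) d f (z, r)
        = (-1) * dirDeriv (cylinder Ω T) d (lapseSq Ω T U) (z, r) + (-ε) * d.2 := fun d => by
      have h1 := dirDeriv_linComb hS hZs hGs (-1) (-ε) d hq
      simp only [hGd d hq] at h1
      exact h1
    have hmr : m ≤ lapseSq Ω T U (z, r) := by
      by_cases hzint : z ∈ Ω
      · obtain rfl | hpos := hr.1.eq_or_lt
        · exact hinit z hz
        exfalso
        have hcrit : ∀ i, grad Ω T (lapseSq Ω T U) i (z, r) = 0 := fun i => by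
          have h1 := (hint hzint (Pi.single i 1)).1
          rw [hfd] at h1
          change (-1) * grad Ω T (lapseSq Ω T U) i (z, r) + (-ε) * 0 = 0 at h1
          linarith
        have hevol := hU.lapseSq_evolution hΩo hS hq hcrit
        have hZ := hU.lapseSq_pos _ hq
        have hPP := principalPart_nonpos hΩo hS hfs hq hZ.le fun d => (hint hzint d).2
        have hG2 : ∀ i j, hess Ω T G i j (z, r) = 0 := fun i j => by
          have h1 := dirDeriv_congr (hGd (spaceDir j)) (spaceDir i) hq
          refine Eq.trans h1 ?_
          simp [dirDeriv]
        have hPG : principalPart Ω T U G (z, r) = 0 := by simp [principalPart, hG2]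
        rw [hf, principalPart_linComb hS hZs hGs _ _ hq, hPG] at hPP
        have htime := hrt hpos
        rw [hfd] at htime
        change 0 ≤ (-1) * timeDeriv Ω T (lapseSq Ω T U) (z, r) + (-ε) * 1 at htime
        have h2 : lapseSq Ω T U (z, r) * timeDeriv Ω T (lapseSq Ω T U) (z, r) < 0 :=
          mul_neg_of_pos_of_neg hZ (by linarith)
        have h3 : 0 ≤ 2 * lapseSq Ω T U (z, r) * (hess Ω T U 0 0 (z, r) ^ 2
          + 2 * hess Ω T U 0 1 (z, r) ^ 2 + hess Ω T U 1 1 (z, r) ^ 2) := by positivity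
        linarith
      · have hzf : z ∈ frontier Ω := ⟨hz, fun h => hzint (interior_subset h)⟩
        obtain ⟨s, rfl⟩ := hcrange ▸ hzf
        have h1 := htan s rfl
        have h2 := hout x₀ hx₀
        rw [hfd] at h1 h2
        exact hbdry s r hq.2 (by linarith) (by linarith)
    have h1 := hmax x hx t ⟨ht.1, le_rfl⟩
    simp only [hf, hG] at h1
    have h2 := mul_nonneg hε.le hr.1
    linarith
  have hlim : Tendsto (fun ε : ℝ => m - ε * t) (𝓝[>] 0) (𝓝 m) := by
    have : Continuous fun ε : ℝ => m - ε * t := by fun_prop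
    have h := this.tendsto 0
    simp only [zero_mul, sub_zero] at h
    exact h.mono_left nhdsWithin_le_nhds
  exact le_of_tendsto hlim (eventually_mem_nhdsWithin.mono fun ε hε => key ε hε)

end GradientBound

end Helpers

/-- **Gradient estimate in dimension 2** (Proposition 4 / `Gradest`):
for a smooth solution `u` of graphical spacelike mean curvature flow with
`α`-Neumann boundary condition on a compact strictly convex smooth domain
`Ω ⊂ ℝ²`, the gradient function `v = 1/√(1-|Du|²)` is bounded by
`C = max{2√(1+ᾱ²), (1+ᾱ²)(κ̲⁻¹ᾱC_H + κ̲⁻¹(2ᾱ²+1)C_α + 1), sup_{t=0} v}`,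
where `ᾱ ≥ sup_∂Ω|α|`, `C_α ≥ sup_∂Ω|dα/ds|`, `0 < κ̲ ≤ inf κ`,
`C_H ≥ sup_Ω |u_t(·,0)|` and `V₀ ≥ sup_Ω 1/√(1-|Du₀|²)`.
In particular `|Du|² ≤ 1 - 1/C²` is bounded away from `1` uniformly in `t`. -/
theorem gradient_estimate_dim2
    (Ω : Set (Fin 2 → ℝ)) (hΩo : IsOpen Ω) (hΩconv : Convex ℝ Ω)
    (hΩbd : Bornology.IsBounded Ω) (hΩne : Ω.Nonempty)
    -- `γ` is the outward unit normal of `∂Ω`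
    (γ : (Fin 2 → ℝ) → Fin 2 → ℝ)
    (hγunit : ∀ x ∈ frontier Ω, ∑ i, (γ x i) ^ 2 = 1)
    (hγout : ∀ x ∈ frontier Ω, ∀ y ∈ Ω, ∑ i, γ x i * (y i - x i) ≤ 0)
    -- smooth boundary: a smooth unit-speed parametrisation `c` of `∂Ω`;
    -- strict convexity: the curvature `κ` of `∂Ω` is positive, `c'' = -κ • γ∘c`
    (c : ℝ → Fin 2 → ℝ) (κ : ℝ → ℝ)
    (hc : ContDiff ℝ (⊤ : ℕ∞) c) (hcrange : range c = frontier Ω)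
    (hcunit : ∀ s, ∑ i, (deriv c s i) ^ 2 = 1)
    (hccurv : ∀ s, deriv (deriv c) s = (-(κ s)) • γ (c s))
    (hκpos : ∀ s, 0 < κ s)
    -- smooth boundary angle prescription
    (α : (Fin 2 → ℝ) → ℝ) (hαs : ContDiffOn ℝ (⊤ : ℕ∞) α (frontier Ω))
    -- the solution
    (T : ℝ) (hT : 0 < T)
    (u : (Fin 2 → ℝ) → ℝ → ℝ)
    (hu : IsGraphMCF Ω γ α (Ico 0 T) u)
    -- the constants:  ᾱ = sup_∂Ω |α|
    (αbar : ℝ) (hαbar : ∀ x ∈ frontier Ω, |α x| ≤ αbar)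
    -- C_α = sup |dα/ds|, the tangential derivative of α along the boundary curve
    (Cα : ℝ) (hCα : ∀ s : ℝ, |deriv (fun r => α (c r)) s| ≤ Cα)
    -- κ̲ = inf_∂Ω κ > 0
    (κlow : ℝ) (hκlow : 0 < κlow) (hκlow' : ∀ s, κlow ≤ κ s)
    -- C_H = sup_Ω |u_t(·,0)|
    (CH : ℝ) (hCH : ∀ x ∈ Ω, |derivWithin (fun s => u x s) (Ico 0 T) 0| ≤ CH)
    -- V₀ = sup_Ω 1/√(1-|Du₀|²), for the initial datum u₀ = u(·,0)
    (V₀ : ℝ) (hV₀ : ∀ x ∈ Ω, 1 / Real.sqrt (1 - spGradSq Ω u x 0) ≤ V₀)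
    -- the constant C
    (C : ℝ)
    (hC : C = max (max (2 * Real.sqrt (1 + αbar ^ 2))
      ((1 + αbar ^ 2) * (κlow⁻¹ * αbar * CH + κlow⁻¹ * (2 * αbar ^ 2 + 1) * Cα + 1))) V₀) :
    ∀ x ∈ closure Ω, ∀ t ∈ Ico (0 : ℝ) T,
      1 / Real.sqrt (1 - spGradSq Ω u x t) ≤ C ∧
      spGradSq Ω u x t ≤ 1 - 1 / C ^ 2 := by
  obtain ⟨x₀, hx₀⟩ := hΩne
  obtain ⟨hU, hsq, htime⟩ := hu.isFlow hΩo hΩconv ⟨x₀, hx₀⟩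
  set U : (Fin 2 → ℝ) × ℝ → ℝ := fun q => u q.1 q.2
  have hS := uniqueDiffOn_cylinder (T := T) hΩo hΩconv ⟨x₀, hx₀⟩
  have hT0 : (0 : ℝ) ∈ Ico 0 T := ⟨le_rfl, hT⟩
  have hC1 : 2 * √(1 + αbar ^ 2) ≤ C := by
    rw [hC]; exact (le_max_left _ _).trans (le_max_left _ _)
  have hC2 : (1 + αbar ^ 2) * (κlow⁻¹ * αbar * CH + κlow⁻¹ * (2 * αbar ^ 2 + 1) * Cα + 1) ≤ C := by
    rw [hC]; exact (le_max_right _ _).trans (le_max_left _ _)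
  have hC3 : V₀ ≤ C := by rw [hC]; exact le_max_right _ _
  have hCpos : 0 < C := lt_of_lt_of_le (by positivity) hC1
  have hlower : ∀ q ∈ cylinder Ω T, 1 ≤ C * √(lapseSq Ω T U q) →
      1 / C ^ 2 ≤ lapseSq Ω T U q := by
    intro q hq h
    have h1 : (1 : ℝ) ≤ (C * √(lapseSq Ω T U q)) ^ 2 := one_le_pow₀ h
    rw [mul_pow, Real.sq_sqrt (hU.lapseSq_pos q hq).le] at h1
    rwa [div_le_iff₀' (by positivity)]
  have hperp := inner_normal_tangent hcunit hc hccurv hκpos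
  have hwbound : ∀ σ : ℝ, |σ| = 1 → ∀ x ∈ closure Ω, ∀ t ∈ Ico 0 T,
      σ * timeDeriv Ω T U (x, t) ≤ CH := by
    intro σ hσ x hx t ht
    refine hU.timeDeriv_le hΩo hΩconv hΩbd ⟨x₀, hx₀⟩ hγunit hγout hc hcrange hcunit hperp ?_ hx ht
    refine le_on_initial_closure (f := fun q => σ * timeDeriv Ω T U q) hT
      (contDiffOn_const.mul (hU.smooth.timeDeriv hS)) fun y hy => ?_
    rw [← htime y (subset_closure hy) 0 hT0]
    refine (le_abs_self _).trans ?_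
    rw [abs_mul, hσ, one_mul]
    exact hCH y hy
  have hw : ∀ x ∈ closure Ω, ∀ t ∈ Ico 0 T, |timeDeriv Ω T U (x, t)| ≤ CH := by
    intro x hx t ht
    have h1 := hwbound 1 (by simp) x hx t ht
    have h2 := hwbound (-1) (by simp) x hx t ht
    exact abs_le.2 ⟨by linarith, by linarith⟩
  have hinit : ∀ x ∈ closure Ω, 1 / C ^ 2 ≤ lapseSq Ω T U (x, 0) := by
    have h := le_on_initial_closure (f := fun q => -lapseSq Ω T U q) (M := -(1 / C ^ 2)) hT
      (hU.smooth.lapseSq hS).neg fun y hy => ?_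
    · exact fun x hx => neg_le_neg_iff.1 (h x hx)
    · have hyS : (y, (0 : ℝ)) ∈ cylinder Ω T := ⟨subset_closure hy, hT0⟩
      have h1 := (hV₀ y hy).trans hC3
      rw [hsq y (subset_closure hy) 0 hT0,
        div_le_iff₀ (Real.sqrt_pos.2 (hU.lapseSq_pos _ hyS))] at h1
      exact neg_le_neg (hlower _ hyS h1)
  intro x hx t ht
  have hq : (x, t) ∈ cylinder Ω T := ⟨hx, ht⟩
  have hZ : 1 / C ^ 2 ≤ lapseSq Ω T U (x, t) := by
    refine hU.le_lapseSq hΩo hΩconv hΩbd hx₀ hc hcrange hinit (fun s r hr htan hout => ?_) hx ht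
    have hcs : c s ∈ closure Ω := frontier_subset_closure (hcrange ▸ mem_range_self s)
    exact hlower _ ⟨hcs, hr⟩ (hU.one_le_mul_sqrt_lapseSq hΩo hΩconv hγunit hγout hc hcrange hcunit
      hccurv hκpos hαs hαbar hCα hκlow hκlow' hC1 hC2 hr (hw _ hcs r hr) htan hx₀ hout)
  refine ⟨?_, ?_⟩
  · have hsqrt : 1 / C ≤ √(lapseSq Ω T U (x, t)) := by
      refine Real.le_sqrt_of_sq_le ?_
      rwa [div_pow, one_pow]
    rw [hsq x hx t ht, div_le_iff₀ (Real.sqrt_pos.2 (hU.lapseSq_pos _ hq))]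
    rwa [div_le_iff₀' hCpos] at hsqrt
  · linarith [hsq x hx t ht]
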